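/- arXiv:1111.2801 — 2 statements merged into one kernel-verified Lean document; each statement's English description precedes it below -/
import Mathlib

section
/- Let Ω ⊂ ℝⁿ be a smooth bounded domain with n ≥ 5, let g be a C^∞ function, and let u, smooth on the closure of Ω, be a semi-stable classical solution of −Δu = g(u) in Ω with u = 0 on ∂Ω. Then there exists a constant C(n) depending only on n such that for all s > 0 one has ( ∫_{{|u|>s}} (|u|−s)^{2n/(n−4)} dx )^{(n−4)/(2n)} ≤ (C(n)/s) ( ∫_{{|u| ≤ s}} |∇u|⁴ dx )^{1/2}. -/
open MeasureTheory Filter Bornology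
open scoped ENNReal Topology

/-- Divergence of a vector field on `ℝⁿ = EuclideanSpace ℝ (Fin n)`. -/
noncomputable def divg {n : ℕ} (V : EuclideanSpace ℝ (Fin n) → EuclideanSpace ℝ (Fin n))
    (x : EuclideanSpace ℝ (Fin n)) : ℝ :=
  ∑ i, fderiv ℝ V x (EuclideanSpace.single i 1) i

/-- `H_u(x) = -(1/(n-1)) div(∇u/|∇u|)(x)`, the mean curvature of the level set of `|u|`
through `x` (at points where `∇u(x) ≠ 0`). -/
noncomputable def meanCurv {n : ℕ} (u : EuclideanSpace ℝ (Fin n) → ℝ)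
    (x : EuclideanSpace ℝ (Fin n)) : ℝ :=
  -(1 / ((n : ℝ) - 1)) * divg (fun y => ‖gradient u y‖⁻¹ • gradient u y) x

/-- The Laplacian `Δu = div ∇u` on `ℝⁿ`. -/
noncomputable def lap {n : ℕ} (u : EuclideanSpace ℝ (Fin n) → ℝ)
    (x : EuclideanSpace ℝ (Fin n)) : ℝ :=
  divg (gradient u) x

/-- Semi-stability of a solution `u` of `-Δu = g(u)` in `Ω`, `u = 0` on `∂Ω`:
`∫_Ω (|∇ξ|² - g'(u) ξ²) dx ≥ 0` for every `C¹` function `ξ` vanishing on `∂Ω`. -/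
def SemiStable {n : ℕ} (Ω : Set (EuclideanSpace ℝ (Fin n))) (g : ℝ → ℝ)
    (u : EuclideanSpace ℝ (Fin n) → ℝ) : Prop :=
  ∀ ξ : EuclideanSpace ℝ (Fin n) → ℝ, ContDiff ℝ 1 ξ → (∀ x ∈ frontier Ω, ξ x = 0) →
    0 ≤ ∫ x in Ω, (‖gradient ξ x‖ ^ 2 - deriv g (u x) * ξ x ^ 2)

/-- The `i`-th partial derivative. -/
noncomputable def pderiv {n : ℕ} (i : Fin n) (f : EuclideanSpace ℝ (Fin n) → ℝ)
    (x : EuclideanSpace ℝ (Fin n)) : ℝ :=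
  fderiv ℝ f x (EuclideanSpace.single i 1)

section Calculus

variable {n : ℕ} {f g : EuclideanSpace ℝ (Fin n) → ℝ} {x : EuclideanSpace ℝ (Fin n)}

lemma pderiv_add (i : Fin n) (hf : DifferentiableAt ℝ f x) (hg : DifferentiableAt ℝ g x) :
    pderiv i (fun y => f y + g y) x = pderiv i f x + pderiv i g x := by
  simp [pderiv, fderiv_fun_add hf hg]

lemma pderiv_sub (i : Fin n) (hf : DifferentiableAt ℝ f x) (hg : DifferentiableAt ℝ g x) :
    pderiv i (fun y => f y - g y) x = pderiv i f x - pderiv i g x := by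
  simp [pderiv, fderiv_fun_sub hf hg]

lemma pderiv_mul (i : Fin n) (hf : DifferentiableAt ℝ f x) (hg : DifferentiableAt ℝ g x) :
    pderiv i (fun y => f y * g y) x = pderiv i f x * g x + f x * pderiv i g x := by
  simp [pderiv, fderiv_fun_mul hf hg]; ring

lemma pderiv_sum {ι : Type*} (s : Finset ι) {F : ι → EuclideanSpace ℝ (Fin n) → ℝ} (i : Fin n)
    (hF : ∀ j ∈ s, DifferentiableAt ℝ (F j) x) :
    pderiv i (fun y => ∑ j ∈ s, F j y) x = ∑ j ∈ s, pderiv i (F j) x := by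
  simp [pderiv, fderiv_fun_sum hF]

lemma pderiv_comp {h : ℝ → ℝ} (i : Fin n) (hh : DifferentiableAt ℝ h (f x))
    (hf : DifferentiableAt ℝ f x) :
    pderiv i (fun y => h (f y)) x = deriv h (f x) * pderiv i f x := by
  have := (hh.hasDerivAt.comp_hasFDerivAt x hf.hasFDerivAt).fderiv
  simp only [Function.comp_def] at this
  simp [pderiv, this]

lemma pderiv_congr (i : Fin n) (h : f =ᶠ[𝓝 x] g) : pderiv i f x = pderiv i g x := by
  simp [pderiv, h.fderiv_eq]

lemma pderiv_coord (i j : Fin n) (c : ℝ) :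
    pderiv i (fun y : EuclideanSpace ℝ (Fin n) => y j - c) x = if j = i then 1 else 0 := by
  have h : HasFDerivAt (fun y : EuclideanSpace ℝ (Fin n) => y j - c)
      (EuclideanSpace.proj j : EuclideanSpace ℝ (Fin n) →L[ℝ] ℝ) x :=
    (EuclideanSpace.proj j : EuclideanSpace ℝ (Fin n) →L[ℝ] ℝ).hasFDerivAt.sub_const c
  simp [pderiv, h.fderiv]

lemma ContDiff.pderiv (i : Fin n) (hf : ContDiff ℝ (⊤ : ℕ∞) f) :
    ContDiff ℝ (⊤ : ℕ∞) (pderiv i f) := by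
  unfold _root_.pderiv
  exact (hf.fderiv_right (m := (⊤ : ℕ∞)) (by simp)).clm_apply contDiff_const

lemma ContDiff.continuous_pderiv (i : Fin n) (hf : ContDiff ℝ 1 f) :
    Continuous (_root_.pderiv i f) := by
  unfold _root_.pderiv
  exact (hf.continuous_fderiv (by simp)).clm_apply continuous_const

lemma pderiv_comm (i j : Fin n) (hf : ContDiff ℝ (⊤ : ℕ∞) f) :
    pderiv i (pderiv j f) = pderiv j (pderiv i f) := by
  ext x
  have hd : DifferentiableAt ℝ (fderiv ℝ f) x :=
    ((hf.fderiv_right (m := (⊤ : ℕ∞)) (by simp)).differentiable (by simp)) x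
  have key : ∀ k l : Fin n, pderiv k (pderiv l f) x =
      fderiv ℝ (fderiv ℝ f) x (EuclideanSpace.single k 1) (EuclideanSpace.single l 1) := by
    intro k l
    have : pderiv l f = fun y => fderiv ℝ f y (EuclideanSpace.single l 1) := rfl
    rw [this, pderiv, fderiv_clm_apply hd (by fun_prop)]
    simp
  rw [key, key]
  have h2 : minSmoothness ℝ 2 ≤ ((⊤ : ℕ∞) : WithTop ℕ∞) := by
    simpa using WithTop.coe_le_coe.2 (le_top : (2 : ℕ∞) ≤ ⊤)
  exact (hf.contDiffAt.isSymmSndFDerivAt h2) _ _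

lemma gradient_apply (i : Fin n) :
    gradient f x i = pderiv i f x := by
  have := InnerProductSpace.toDual_symm_apply (𝕜 := ℝ) (x := EuclideanSpace.single i (1 : ℝ))
    (y := fderiv ℝ f x)
  rw [EuclideanSpace.inner_single_right] at this
  simpa [pderiv, gradient] using this

lemma norm_gradient_sq :
    ‖gradient f x‖ ^ 2 = ∑ i, pderiv i f x ^ 2 := by
  rw [EuclideanSpace.norm_sq_eq]
  simp [gradient_apply]

lemma norm_fderiv_eq_norm_gradient : ‖fderiv ℝ f x‖ = ‖gradient f x‖ := by
  simp [gradient]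

lemma lap_eq (hf : ContDiff ℝ (⊤ : ℕ∞) f) : lap f x = ∑ i, pderiv i (pderiv i f) x := by
  have hg : Differentiable ℝ (gradient f) := by
    unfold gradient
    exact (InnerProductSpace.toDual ℝ (EuclideanSpace ℝ (Fin n))).symm.differentiable.comp
      ((hf.fderiv_right (m := (⊤ : ℕ∞)) (by simp)).differentiable (by simp))
  unfold lap divg
  refine Finset.sum_congr rfl fun i _ => ?_
  have h1 : HasFDerivAt (fun y => gradient f y i)
      ((EuclideanSpace.proj i : EuclideanSpace ℝ (Fin n) →L[ℝ] ℝ).comp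
        (fderiv ℝ (gradient f) x)) x :=
    (EuclideanSpace.proj i : EuclideanSpace ℝ (Fin n) →L[ℝ] ℝ).hasFDerivAt.comp x
      (hg x).hasFDerivAt
  have h2 : (fun y => gradient f y i) = pderiv i f := by
    ext y
    exact gradient_apply i
  rw [h2] at h1
  rw [pderiv, h1.fderiv]
  simp

lemma integrable_pderiv (i : Fin n) (hf : ContDiff ℝ 1 f) (hc : HasCompactSupport f) :
    Integrable (fun x => pderiv i f x) := by
  refine (hf.continuous_pderiv i).integrable_of_hasCompactSupport ?_
  refine (hc.fderiv (𝕜 := ℝ)).comp_left (g := fun L => L (EuclideanSpace.single i 1)) ?_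
  simp

lemma integral_pderiv_eq_zero (i : Fin n) (hf : ContDiff ℝ 1 f) (hc : HasCompactSupport f) :
    ∫ x, pderiv i f x = 0 := by
  have := integral_mul_fderiv_eq_neg_fderiv_mul_of_integrable (μ := volume)
    (f := fun _ : EuclideanSpace ℝ (Fin n) => (1 : ℝ)) (g := f)
    (v := EuclideanSpace.single i 1) (by simp)
    (by simp only [one_mul]; exact integrable_pderiv i hf hc)
    (by simpa using hf.continuous.integrable_of_hasCompactSupport hc)
    (fun _ _ => by fun_prop) (fun x _ => hf.differentiable (by simp) x)
  simpa [pderiv] using this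

end Calculus

section Localization

variable {n : ℕ} {Ω : Set (EuclideanSpace ℝ (Fin n))} {u : EuclideanSpace ℝ (Fin n) → ℝ}
  {h : ℝ → ℝ} {δ : ℝ}

lemma indicator_comp_eventuallyEq (hΩ : IsOpen Ω) (hu : Continuous u)
    (hb : ∀ x ∈ frontier Ω, u x = 0) (hδ : 0 < δ) (h0 : ∀ t ≤ δ, h t = 0)
    (x : EuclideanSpace ℝ (Fin n)) :
    (x ∈ Ω → Ω.indicator (fun y => h (u y)) =ᶠ[𝓝 x] fun y => h (u y)) ∧
    (x ∉ Ω → Ω.indicator (fun y => h (u y)) =ᶠ[𝓝 x] fun _ => 0) := by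
  constructor
  · intro hx
    filter_upwards [hΩ.mem_nhds hx] with y hy
    simp [hy]
  · intro hx
    by_cases hxc : x ∈ closure Ω
    · have hxf : u x = 0 := hb x (by rw [hΩ.frontier_eq]; exact ⟨hxc, hx⟩)
      have : ∀ᶠ y in 𝓝 x, u y < δ := hu.continuousAt.eventually_lt_const (by rw [hxf]; exact hδ)
      filter_upwards [this] with y hy
      by_cases hyΩ : y ∈ Ω
      · simp [hyΩ, h0 _ hy.le]
      · simp [hyΩ]
    · filter_upwards [isClosed_closure.isOpen_compl.mem_nhds hxc] with y hy
      exact Set.indicator_of_notMem (fun h' => hy (subset_closure h')) _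

lemma contDiff_indicator_comp (hΩ : IsOpen Ω) (hu : ContDiff ℝ (⊤ : ℕ∞) u)
    (hb : ∀ x ∈ frontier Ω, u x = 0) (hδ : 0 < δ) (h0 : ∀ t ≤ δ, h t = 0)
    (hh : ContDiff ℝ (⊤ : ℕ∞) h) :
    ContDiff ℝ (⊤ : ℕ∞) (Ω.indicator fun y => h (u y)) := by
  rw [contDiff_iff_contDiffAt]
  intro x
  obtain ⟨h1, h2⟩ := indicator_comp_eventuallyEq hΩ hu.continuous hb hδ h0 x
  by_cases hx : x ∈ Ω
  · exact (hh.comp hu).contDiffAt.congr_of_eventuallyEq (h1 hx)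
  · exact contDiffAt_const.congr_of_eventuallyEq (h2 hx)

lemma pderiv_indicator_comp (hΩ : IsOpen Ω) (hu : ContDiff ℝ (⊤ : ℕ∞) u)
    (hb : ∀ x ∈ frontier Ω, u x = 0) (hδ : 0 < δ) (h0 : ∀ t ≤ δ, h t = 0)
    (hh : ContDiff ℝ (⊤ : ℕ∞) h) (i : Fin n) (x : EuclideanSpace ℝ (Fin n)) :
    pderiv i (Ω.indicator fun y => h (u y)) x =
      Ω.indicator (fun y => deriv h (u y)) x * pderiv i u x := by
  obtain ⟨h1, h2⟩ := indicator_comp_eventuallyEq hΩ hu.continuous hb hδ h0 x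
  by_cases hx : x ∈ Ω
  · rw [pderiv_congr i (h1 hx), pderiv_comp i (hh.differentiable (by simp) _)
      (hu.differentiable (by simp) x)]
    simp [hx]
  · rw [pderiv_congr i (h2 hx)]
    simp [hx, pderiv]

lemma hasCompactSupport_indicator (hΩb : IsBounded Ω) (F : EuclideanSpace ℝ (Fin n) → ℝ) :
    HasCompactSupport (Ω.indicator F) :=
  Metric.isCompact_of_isClosed_isBounded (isClosed_tsupport _)
    (hΩb.subset Set.support_indicator_subset).closure

end Localization

section Stability

variable {n : ℕ}

/-- `|∇u|²`. -/
noncomputable def gradSq (u : EuclideanSpace ℝ (Fin n) → ℝ) (x : EuclideanSpace ℝ (Fin n)) : ℝ :=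
  ∑ i, pderiv i u x ^ 2

/-- The components of `D²u ∇u`. -/
noncomputable def hessGrad (u : EuclideanSpace ℝ (Fin n) → ℝ) (i : Fin n)
    (x : EuclideanSpace ℝ (Fin n)) : ℝ :=
  ∑ j, pderiv i (pderiv j u) x * pderiv j u x

/-- `|D²u|²`. -/
noncomputable def hessSq (u : EuclideanSpace ℝ (Fin n) → ℝ) (x : EuclideanSpace ℝ (Fin n)) : ℝ :=
  ∑ i, ∑ j, pderiv i (pderiv j u) x ^ 2

/-- `|D²u|² - |D²u ν|²` with `ν = ∇u/|∇u|`; this equals `|∇u|² |A|² + |∇_T |∇u||²`, where `A` is the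
second fundamental form of the level set and `∇_T` the tangential gradient. -/
noncomputable def tangHess (u : EuclideanSpace ℝ (Fin n) → ℝ) (x : EuclideanSpace ℝ (Fin n)) : ℝ :=
  hessSq u x - (∑ i, hessGrad u i x ^ 2) / gradSq u x

variable {Ω : Set (EuclideanSpace ℝ (Fin n))} {u : EuclideanSpace ℝ (Fin n) → ℝ}
  {x : EuclideanSpace ℝ (Fin n)}

lemma gradSq_nonneg : 0 ≤ gradSq u x := Finset.sum_nonneg fun _ _ => sq_nonneg _

lemma gradSq_eq : gradSq u x = ‖gradient u x‖ ^ 2 := norm_gradient_sq.symm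

lemma contDiff_gradSq (hu : ContDiff ℝ (⊤ : ℕ∞) u) : ContDiff ℝ (⊤ : ℕ∞) (gradSq u) := by
  unfold gradSq
  exact ContDiff.sum fun i _ => (hu.pderiv i).pow 2

lemma contDiff_hessGrad (hu : ContDiff ℝ (⊤ : ℕ∞) u) (i : Fin n) :
    ContDiff ℝ (⊤ : ℕ∞) (hessGrad u i) := by
  unfold hessGrad
  exact ContDiff.sum fun j _ => ((hu.pderiv j).pderiv i).mul (hu.pderiv j)

lemma continuous_hessSq (hu : ContDiff ℝ (⊤ : ℕ∞) u) : Continuous (hessSq u) := by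
  unfold hessSq
  exact continuous_finsetSum _ fun i _ => continuous_finsetSum _ fun j _ =>
    ((hu.pderiv j).pderiv i).continuous.pow 2

lemma sum_hessGrad_sq_le : ∑ i, hessGrad u i x ^ 2 ≤ hessSq u x * gradSq u x := by
  unfold hessSq gradSq hessGrad
  rw [Finset.sum_mul]
  exact Finset.sum_le_sum fun i _ => Finset.sum_mul_sq_le_sq_mul_sq _ _ _

lemma tangHess_nonneg : 0 ≤ tangHess u x := by
  unfold tangHess
  rw [sub_nonneg]
  rcases gradSq_nonneg.eq_or_lt (a := (0 : ℝ)) (b := gradSq u x) with h | h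
  · rw [← h, div_zero]
    exact Finset.sum_nonneg fun _ _ => Finset.sum_nonneg fun _ _ => sq_nonneg _
  · rw [div_le_iff₀ h]
    exact sum_hessGrad_sq_le

lemma measurable_tangHess (hu : ContDiff ℝ (⊤ : ℕ∞) u) : Measurable (tangHess u) := by
  unfold tangHess
  refine (continuous_hessSq hu).measurable.sub (Measurable.div ?_ ?_)
  · exact (continuous_finsetSum _ fun i _ =>
      ((contDiff_hessGrad hu i).continuous.pow 2)).measurable
  · exact (contDiff_gradSq hu).continuous.measurable

lemma tangHess_le_hessSq : tangHess u x ≤ hessSq u x := by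
  unfold tangHess
  have : 0 ≤ (∑ i, hessGrad u i x ^ 2) / gradSq u x :=
    div_nonneg (Finset.sum_nonneg fun _ _ => sq_nonneg _) gradSq_nonneg
  linarith

lemma tangHess_le {ε : ℝ} (hε : 0 < ε) :
    tangHess u x ≤ hessSq u x - (∑ i, hessGrad u i x ^ 2) / (gradSq u x + ε) := by
  unfold tangHess
  rcases gradSq_nonneg.eq_or_lt (a := (0 : ℝ)) (b := gradSq u x) with h | h
  · have h0 : ∑ i, hessGrad u i x ^ 2 ≤ 0 := by
      simpa [← h] using sum_hessGrad_sq_le (u := u) (x := x)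
    have h1 : ∑ i, hessGrad u i x ^ 2 = 0 :=
      le_antisymm h0 (Finset.sum_nonneg fun _ _ => sq_nonneg _)
    simp [h1]
  · have := div_le_div_of_nonneg_left (a := ∑ i, hessGrad u i x ^ 2)
      (Finset.sum_nonneg fun _ _ => sq_nonneg _) h (by linarith : gradSq u x ≤ gradSq u x + ε)
    linarith

lemma pderiv_gradSq (hu : ContDiff ℝ (⊤ : ℕ∞) u) (i : Fin n) :
    pderiv i (gradSq u) x = 2 * hessGrad u i x := by
  have hd : ∀ j : Fin n, DifferentiableAt ℝ (pderiv j u) x := fun j =>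
    (hu.pderiv j).differentiable (by simp) x
  unfold gradSq hessGrad
  simp_rw [pow_two]
  rw [pderiv_sum _ _ fun j _ => (hd j).fun_mul (hd j), Finset.mul_sum]
  refine Finset.sum_congr rfl fun j _ => ?_
  rw [pderiv_mul i (hd j) (hd j)]
  ring

/-- Bochner's formula for solutions of `-Δu = g(u)`. -/
lemma sum_pderiv_hessGrad (hΩ : IsOpen Ω) {g : ℝ → ℝ} (hg : ContDiff ℝ (⊤ : ℕ∞) g)
    (hu : ContDiff ℝ (⊤ : ℕ∞) u) (heq : ∀ x ∈ Ω, -lap u x = g (u x)) (hx : x ∈ Ω) :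
    ∑ i, pderiv i (hessGrad u i) x = hessSq u x - deriv g (u x) * gradSq u x := by
  have hd : ∀ j : Fin n, DifferentiableAt ℝ (pderiv j u) x := fun j =>
    (hu.pderiv j).differentiable (by simp) x
  have hd2 : ∀ i j : Fin n, DifferentiableAt ℝ (pderiv i (pderiv j u)) x := fun i j =>
    ((hu.pderiv j).pderiv i).differentiable (by simp) x
  have hlap : ∀ j, ∑ i, pderiv i (pderiv i (pderiv j u)) x
      = -(deriv g (u x) * pderiv j u x) := by
    intro j
    have h1 : ∀ i, pderiv i (pderiv i (pderiv j u)) = pderiv j (pderiv i (pderiv i u)) := by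
      intro i
      rw [pderiv_comm i j hu, pderiv_comm i j (hu.pderiv i)]
    simp_rw [h1]
    rw [← pderiv_sum _ _ fun i _ => hd2 i i, ← pderiv_comp j (hg.differentiable (by simp) _)
      (hu.differentiable (by simp) x)]
    have h2 : (fun y => ∑ i, pderiv i (pderiv i u) y) =ᶠ[𝓝 x] fun y => (0 : ℝ) - g (u y) := by
      filter_upwards [hΩ.mem_nhds hx] with y hy
      rw [← lap_eq hu, ← heq y hy]
      ring
    rw [pderiv_congr j h2, pderiv_sub (f := fun _ => 0) (g := fun y => g (u y)) j (by fun_prop)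
      ((hg.comp hu).differentiable (by simp) x)]
    simp [pderiv]
  have h3 : ∀ i, pderiv i (hessGrad u i) x = ∑ j, (pderiv i (pderiv i (pderiv j u)) x * pderiv j u x
      + pderiv i (pderiv j u) x ^ 2) := by
    intro i
    unfold hessGrad
    rw [pderiv_sum _ _ fun j _ => (hd2 i j).fun_mul (hd j)]
    refine Finset.sum_congr rfl fun j _ => ?_
    rw [pderiv_mul i (hd2 i j) (hd j)]
    ring
  simp_rw [h3, Finset.sum_add_distrib]
  rw [Finset.sum_comm]
  simp_rw [← Finset.sum_mul, hlap]
  unfold hessSq gradSq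
  rw [Finset.mul_sum, add_comm, sub_eq_add_neg, ← Finset.sum_neg_distrib]
  congr 1
  refine Finset.sum_congr rfl fun j _ => ?_
  ring

lemma integrableOn_of_continuous (hΩb : IsBounded Ω) {F : EuclideanSpace ℝ (Fin n) → ℝ}
    (hF : Continuous F) : IntegrableOn F Ω :=
  (hF.continuousOn.integrableOn_compact hΩb.isCompact_closure).mono_set subset_closure

lemma setIntegral_sum_pderiv_eq_zero {F : Fin n → EuclideanSpace ℝ (Fin n) → ℝ}
    (hF : ∀ i, ContDiff ℝ 1 (F i)) (hc : ∀ i, HasCompactSupport (F i))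
    (h0 : ∀ i, ∀ x ∉ Ω, pderiv i (F i) x = 0) :
    ∫ x in Ω, ∑ i, pderiv i (F i) x = 0 := by
  rw [setIntegral_eq_integral_of_forall_compl_eq_zero fun x hx =>
    Finset.sum_eq_zero fun i _ => h0 i x hx,
    integral_finsetSum _ fun i _ => integrable_pderiv i (hF i) (hc i)]
  exact Finset.sum_eq_zero fun i _ => integral_pderiv_eq_zero i (hF i) (hc i)

variable {g f : ℝ → ℝ} {δ : ℝ}

/-- Testing semi-stability with `√(|∇u|² + ε) f(u)`. -/
lemma integral_tangHess_regularized_le (hΩ : IsOpen Ω) (hΩb : IsBounded Ω)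
    (hg : ContDiff ℝ (⊤ : ℕ∞) g) (hu : ContDiff ℝ (⊤ : ℕ∞) u)
    (heq : ∀ x ∈ Ω, -lap u x = g (u x)) (hb : ∀ x ∈ frontier Ω, u x = 0)
    (hst : SemiStable Ω g u) (hδ : 0 < δ) (h0 : ∀ t ≤ δ, f t = 0) (hf : ContDiff ℝ (⊤ : ℕ∞) f)
    {ε : ℝ} (hε : 0 < ε) :
    ∫ x in Ω, f (u x) ^ 2 * (hessSq u x - (∑ i, hessGrad u i x ^ 2) / (gradSq u x + ε)) ≤
      (∫ x in Ω, gradSq u x ^ 2 * deriv f (u x) ^ 2) +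
        ε * ∫ x in Ω, (gradSq u x * deriv f (u x) ^ 2 - deriv g (u x) * f (u x) ^ 2) := by
  set θ := Ω.indicator fun y => f (u y) with hθ
  have hθs : ContDiff ℝ (⊤ : ℕ∞) θ := contDiff_indicator_comp hΩ hu hb hδ h0 hf
  have hP := contDiff_gradSq hu
  have hpos : ∀ x, 0 < gradSq u x + ε := fun x => by linarith [gradSq_nonneg (u := u) (x := x)]
  have hw : ContDiff ℝ (⊤ : ℕ∞) fun x => √(gradSq u x + ε) :=
    (hP.add contDiff_const).sqrt fun x => (hpos x).ne'
  have hξ : ContDiff ℝ (⊤ : ℕ∞) fun x => θ x * √(gradSq u x + ε) := hθs.mul hw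
  have hF : ∀ i, ContDiff ℝ (⊤ : ℕ∞) fun x => (θ x * θ x) * hessGrad u i x := fun i =>
    (hθs.mul hθs).mul (contDiff_hessGrad hu i)
  have hθc : HasCompactSupport θ := hasCompactSupport_indicator hΩb _
  have key := hst _ (hξ.of_le (by simp)) (fun x hx => by
    have : x ∉ Ω := by
      rw [hΩ.frontier_eq] at hx; exact hx.2
    simp [hθ, this])
  have hdθ : ∀ i x, pderiv i θ x = Ω.indicator (fun y => deriv f (u y)) x * pderiv i u x :=
    fun i x => pderiv_indicator_comp hΩ hu hb hδ h0 hf i x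
  have hdF : ∀ i x, pderiv i (fun x => (θ x * θ x) * hessGrad u i x) x =
      2 * θ x * pderiv i θ x * hessGrad u i x + θ x ^ 2 * pderiv i (hessGrad u i) x := by
    intro i x
    have h1 := hθs.differentiable (by simp) x
    rw [pderiv_mul i (h1.fun_mul h1) ((contDiff_hessGrad hu i).differentiable (by simp) x),
      pderiv_mul i h1 h1]
    ring
  have hdiv := setIntegral_sum_pderiv_eq_zero (Ω := Ω) (fun i => (hF i).of_le (by simp))
    (fun i => (hθc.mul_right (f' := θ)).mul_right (f' := hessGrad u i)) (fun i x hx => by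
      rw [hdF]; simp [hθ, hx])
  have hid : ∀ x ∈ Ω, ‖gradient (fun x => θ x * √(gradSq u x + ε)) x‖ ^ 2
      - deriv g (u x) * (θ x * √(gradSq u x + ε)) ^ 2 =
      (∑ i, pderiv i (fun x => (θ x * θ x) * hessGrad u i x) x)
      + (gradSq u x ^ 2 * deriv f (u x) ^ 2
        + ε * (gradSq u x * deriv f (u x) ^ 2 - deriv g (u x) * f (u x) ^ 2)
        - f (u x) ^ 2 * (hessSq u x - (∑ i, hessGrad u i x ^ 2) / (gradSq u x + ε))) := by
    intro x hx
    have hθx : θ x = f (u x) := by simp [hθ, hx]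
    have hdθx : ∀ i, pderiv i θ x = deriv f (u x) * pderiv i u x := by
      intro i; rw [hdθ]; simp [hx]
    have hdw : ∀ i, pderiv i (fun x => √(gradSq u x + ε)) x
        = hessGrad u i x / √(gradSq u x + ε) := by
      intro i
      have hPd : DifferentiableAt ℝ (gradSq u) x := hP.differentiable (by simp) x
      have hs := Real.hasDerivAt_sqrt (hpos x).ne'
      rw [pderiv_comp (f := fun x => gradSq u x + ε) i hs.differentiableAt (by fun_prop), hs.deriv,
        pderiv_add i hPd (by fun_prop), pderiv_gradSq hu]
      have : pderiv i (fun _ => ε) x = 0 := by simp [pderiv]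
      rw [this]
      field_simp
      ring
    have hB := sum_pderiv_hessGrad hΩ hg hu heq hx
    rw [norm_gradient_sq]
    simp_rw [hdF, pderiv_mul _ (hθs.differentiable (by simp) x) (hw.differentiable (by simp) x),
      hdw, hdθx, hθx]
    have hs2 : √(gradSq u x + ε) ^ 2 = gradSq u x + ε := Real.sq_sqrt (hpos x).le
    have hs0 : √(gradSq u x + ε) ≠ 0 := (Real.sqrt_pos.2 (hpos x)).ne'
    have hterm : ∀ i, (deriv f (u x) * pderiv i u x * √(gradSq u x + ε)
        + f (u x) * (hessGrad u i x / √(gradSq u x + ε))) ^ 2 =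
        deriv f (u x) ^ 2 * (gradSq u x + ε) * pderiv i u x ^ 2
        + (2 * f (u x) * (deriv f (u x) * pderiv i u x) * hessGrad u i x
        + f (u x) ^ 2 / (gradSq u x + ε) * hessGrad u i x ^ 2) := by
      intro i
      have aux : ∀ a p G F S : ℝ, S ≠ 0 → (a * p * S + F * (G / S)) ^ 2 =
          a ^ 2 * S ^ 2 * p ^ 2 + (2 * F * (a * p) * G + F ^ 2 / S ^ 2 * G ^ 2) := by
        intro a p G F S hS
        field_simp
        ring
      rw [aux _ _ _ _ _ hs0, hs2]
    simp_rw [hterm, Finset.sum_add_distrib, ← Finset.mul_sum, hB]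
    rw [mul_pow, hs2]
    have : ∑ i, pderiv i u x ^ 2 = gradSq u x := rfl
    rw [this]
    ring
  rw [setIntegral_congr_fun hΩ.measurableSet hid] at key
  have hcf : Continuous fun x => f (u x) := hf.continuous.comp hu.continuous
  have hcdf : Continuous fun x => deriv f (u x) :=
    (hf.continuous_deriv (by simp)).comp hu.continuous
  have hcdg : Continuous fun x => deriv g (u x) :=
    (hg.continuous_deriv (by simp)).comp hu.continuous
  have hcP := hP.continuous
  have hcH := continuous_hessSq hu
  have hcG : Continuous fun x => ∑ i, hessGrad u i x ^ 2 :=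
    continuous_finsetSum _ fun i _ => (contDiff_hessGrad hu i).continuous.pow 2
  have i1 : IntegrableOn (fun x => gradSq u x ^ 2 * deriv f (u x) ^ 2) Ω :=
    integrableOn_of_continuous hΩb (by fun_prop)
  have i2 : IntegrableOn (fun x => ε * (gradSq u x * deriv f (u x) ^ 2
      - deriv g (u x) * f (u x) ^ 2)) Ω := integrableOn_of_continuous hΩb (by fun_prop)
  have i3 : IntegrableOn (fun x => f (u x) ^ 2 *
      (hessSq u x - (∑ i, hessGrad u i x ^ 2) / (gradSq u x + ε))) Ω :=
    integrableOn_of_continuous hΩb ((hcf.pow 2).mul (hcH.sub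
      (hcG.div (hcP.add continuous_const) fun x => (hpos x).ne')))
  have i4 : IntegrableOn (fun x => ∑ i, pderiv i (fun x => (θ x * θ x) * hessGrad u i x) x) Ω :=
    integrable_finsetSum _ fun i _ => (integrable_pderiv i ((hF i).of_le (by simp))
      ((hθc.mul_right (f' := θ)).mul_right (f' := hessGrad u i))).integrableOn
  have hadd := integral_add i4 ((i1.add i2).sub i3)
  have hsub := integral_sub (i1.add i2) i3
  have hadd2 := integral_add i1 i2
  simp only [Pi.add_apply, Pi.sub_apply] at hadd hsub
  rw [integral_const_mul] at hadd2
  rw [hadd, hdiv, hsub, hadd2] at key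
  linarith

/-- The geometric form of semi-stability for test functions `|∇u| f(u)`. -/
lemma lintegral_tangHess_le (hΩ : IsOpen Ω) (hΩb : IsBounded Ω)
    (hg : ContDiff ℝ (⊤ : ℕ∞) g) (hu : ContDiff ℝ (⊤ : ℕ∞) u)
    (heq : ∀ x ∈ Ω, -lap u x = g (u x)) (hb : ∀ x ∈ frontier Ω, u x = 0)
    (hst : SemiStable Ω g u) (hδ : 0 < δ) (h0 : ∀ t ≤ δ, f t = 0) (hf : ContDiff ℝ (⊤ : ℕ∞) f) :
    ∫⁻ x in Ω, ENNReal.ofReal (f (u x) ^ 2 * tangHess u x) ≤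
      ENNReal.ofReal (∫ x in Ω, gradSq u x ^ 2 * deriv f (u x) ^ 2) := by
  set A := ∫ x in Ω, gradSq u x ^ 2 * deriv f (u x) ^ 2
  set B := ∫ x in Ω, (gradSq u x * deriv f (u x) ^ 2 - deriv g (u x) * f (u x) ^ 2)
  have hle : ∀ ε : ℝ, 0 < ε → ∫⁻ x in Ω, ENNReal.ofReal (f (u x) ^ 2 * tangHess u x) ≤
      ENNReal.ofReal (A + ε * B) := by
    intro ε hε
    have hpos : ∀ x, 0 < gradSq u x + ε := fun x => by linarith [gradSq_nonneg (u := u) (x := x)]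
    refine le_trans ?_ (ENNReal.ofReal_le_ofReal
      (integral_tangHess_regularized_le hΩ hΩb hg hu heq hb hst hδ h0 hf hε))
    have hcG : Continuous fun x => ∑ i, hessGrad u i x ^ 2 :=
      continuous_finsetSum _ fun i _ => (contDiff_hessGrad hu i).continuous.pow 2
    rw [ofReal_integral_eq_lintegral_ofReal]
    · refine lintegral_mono fun x => ENNReal.ofReal_le_ofReal ?_
      exact mul_le_mul_of_nonneg_left (tangHess_le hε) (sq_nonneg _)
    · exact integrableOn_of_continuous hΩb (((hf.continuous.comp hu.continuous).pow 2).mul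
        ((continuous_hessSq hu).sub (hcG.div ((contDiff_gradSq hu).continuous.add continuous_const)
          fun x => (hpos x).ne')))
    · exact Eventually.of_forall fun x =>
        mul_nonneg (sq_nonneg _) (tangHess_nonneg.trans (tangHess_le hε))
  have hlim : Tendsto (fun ε : ℝ => ENNReal.ofReal (A + ε * B)) (𝓝[>] 0)
      (𝓝 (ENNReal.ofReal A)) := by
    have : Tendsto (fun ε : ℝ => A + ε * B) (𝓝 0) (𝓝 (A + 0 * B)) :=
      (continuous_const.add (continuous_id.mul continuous_const)).tendsto 0
    simpa using (ENNReal.tendsto_ofReal (this.mono_left nhdsWithin_le_nhds))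
  exact ge_of_tendsto hlim (by filter_upwards [self_mem_nhdsWithin] with ε hε using hle ε hε)

end Stability

section Hardy

variable {n : ℕ}

/-- The part of `D²u` that is seen tangentially to the level sets controls the deviation of `D²u p`
from `(Δu) p` in a direction `z`. -/
lemma sq_hess_sub_trace_le (H : Fin n → Fin n → ℝ) (hH : ∀ i j, H i j = H j i) (p z : Fin n → ℝ) :
    (∑ i, (∑ j, H i j * p j) * z i - (∑ i, p i * z i) * ∑ i, H i i) ^ 2 ≤
      2 * (n + 1) * (∑ i, p i ^ 2) * (∑ i, z i ^ 2) *
        ((∑ i, ∑ j, H i j ^ 2) - (∑ i, (∑ j, H i j * p j) ^ 2) / ∑ i, p i ^ 2) := by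
  set P := ∑ i, p i ^ 2 with hP
  have hP0 : 0 ≤ P := Finset.sum_nonneg fun _ _ => sq_nonneg _
  rcases hP0.eq_or_lt with h | h
  · have hp : ∀ i, p i = 0 := fun i => by
      have := (Finset.sum_eq_zero_iff_of_nonneg (fun i _ => sq_nonneg (p i))).1 (hP ▸ h.symm) i
        (Finset.mem_univ i)
      exact pow_eq_zero_iff (two_ne_zero) |>.1 this
    simp [hp, ← h]
  set G : Fin n → ℝ := fun i => ∑ j, H i j * p j with hG
  have hG' : ∀ j, ∑ i, H i j * p i = G j := fun j => by simp only [hG]; simp_rw [hH _ j]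
  set K : Fin n → Fin n → ℝ := fun i j => H i j - p i * G j / P with hK
  set e := (∑ i, ∑ j, H i j ^ 2) - (∑ i, G i ^ 2) / P with he
  have hKe : ∑ i, ∑ j, K i j ^ 2 = e := by
    have h1 : ∀ i j, K i j ^ 2 = H i j ^ 2 + (-(2 / P) * (G j * (H i j * p i))
        + (1 / P ^ 2) * (p i ^ 2 * G j ^ 2)) := fun i j => by simp only [hK]; ring
    simp_rw [h1, Finset.sum_add_distrib, ← Finset.mul_sum, ← Finset.sum_mul]
    rw [Finset.sum_comm (f := fun i j => G j * (H i j * p i))]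
    simp_rw [← Finset.mul_sum, hG', ← hP]
    have : ∑ i, G i * G i = ∑ i, G i ^ 2 := Finset.sum_congr rfl fun i _ => (pow_two _).symm
    rw [this, he]
    field_simp
    ring
  have he0 : 0 ≤ e := by
    rw [← hKe]
    exact Finset.sum_nonneg fun _ _ => Finset.sum_nonneg fun _ _ => sq_nonneg _
  have hid : ∑ i, G i * z i - (∑ i, p i * z i) * ∑ i, H i i =
      (∑ i, ∑ j, K i j * (z i * p j)) - (∑ i, p i * z i) * ∑ i, K i i := by
    have h1 : ∀ i j, K i j * (z i * p j) = z i * (H i j * p j) - (p i * z i) * (p j * G j) / P :=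
      fun i j => by simp only [hK]; ring
    have h2 : ∀ i, K i i = H i i - p i * G i / P := fun i => rfl
    simp_rw [h1, h2, Finset.sum_sub_distrib, ← Finset.mul_sum, ← Finset.sum_div, ← Finset.mul_sum,
      ← Finset.sum_mul]
    have h3 : ∑ i, z i * ∑ j, H i j * p j = ∑ i, G i * z i :=
      Finset.sum_congr rfl fun i _ => mul_comm _ _
    rw [h3]
    ring
  have hA : (∑ i, ∑ j, K i j * (z i * p j)) ^ 2 ≤ e * ((∑ i, z i ^ 2) * P) := by
    have := Finset.sum_mul_sq_le_sq_mul_sq (Finset.univ : Finset (Fin n × Fin n))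
      (fun k => K k.1 k.2) (fun k => z k.1 * p k.2)
    simp only [← Finset.univ_product_univ, Finset.sum_product] at this
    refine this.trans_eq ?_
    rw [hKe]
    congr 1
    simp_rw [mul_pow]
    rw [hP, Finset.sum_mul_sum]
  have hB : (∑ i, K i i) ^ 2 ≤ n * e := by
    have := Finset.sum_mul_sq_le_sq_mul_sq (Finset.univ : Finset (Fin n)) (fun _ => 1)
      (fun k => K k k)
    simp only [one_mul, one_pow, Finset.sum_const, Finset.card_univ, Fintype.card_fin,
      nsmul_eq_mul, mul_one] at this
    refine this.trans (mul_le_mul_of_nonneg_left ?_ (Nat.cast_nonneg n))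
    rw [← hKe]
    exact Finset.sum_le_sum fun i _ => Finset.single_le_sum (f := fun j => K i j ^ 2)
      (fun j _ => sq_nonneg _) (Finset.mem_univ i)
  have hC : (∑ i, p i * z i) ^ 2 ≤ P * ∑ i, z i ^ 2 := Finset.sum_mul_sq_le_sq_mul_sq _ _ _
  have hD : ((∑ i, p i * z i) * ∑ i, K i i) ^ 2 ≤ (P * ∑ i, z i ^ 2) * (n * e) := by
    rw [mul_pow]
    exact mul_le_mul hC hB (sq_nonneg _)
      (mul_nonneg hP0 (Finset.sum_nonneg fun _ _ => sq_nonneg _))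
  rw [hid]
  nlinarith [sq_nonneg ((∑ i, ∑ j, K i j * (z i * p j)) + (∑ i, p i * z i) * ∑ i, K i i)]

variable {Ω : Set (EuclideanSpace ℝ (Fin n))} {u : EuclideanSpace ℝ (Fin n) → ℝ} {h : ℝ → ℝ}
  {δ : ℝ}

lemma hessGrad_sub_lap_le (hu : ContDiff ℝ (⊤ : ℕ∞) u) (x y : EuclideanSpace ℝ (Fin n)) :
    |∑ i, hessGrad u i x * (x i - y i) - (∑ i, pderiv i u x * (x i - y i)) * lap u x| ≤
      gradSq u x / 2 + (n + 1) * ‖x - y‖ ^ 2 * tangHess u x := by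
  have h1 := sq_hess_sub_trace_le (fun i j => pderiv i (pderiv j u) x)
    (fun i j => by rw [pderiv_comm i j hu]) (fun i => pderiv i u x) (fun i => x i - y i)
  have h2 : ∑ i, (x i - y i) ^ 2 = ‖x - y‖ ^ 2 := by simp [EuclideanSpace.norm_sq_eq]
  rw [h2, ← lap_eq hu] at h1
  refine abs_le_of_sq_le_sq (h1.trans ?_) ?_
  · change 2 * (n + 1) * gradSq u x * ‖x - y‖ ^ 2 * tangHess u x ≤ _
    nlinarith [sq_nonneg (gradSq u x / 2 - (n + 1) * ‖x - y‖ ^ 2 * tangHess u x)]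
  · have := gradSq_nonneg (u := u) (x := x)
    have := tangHess_nonneg (u := u) (x := x)
    positivity

lemma pderiv_rpow_norm_sq_add {ε : ℝ} (hε : 0 < ε) (a : ℝ) (i : Fin n)
    (x y : EuclideanSpace ℝ (Fin n)) :
    pderiv i (fun x => (‖x - y‖ ^ 2 + ε) ^ a) x =
      2 * a * (‖x - y‖ ^ 2 + ε) ^ (a - 1) * (x i - y i) := by
  have hpos : ‖x - y‖ ^ 2 + ε ≠ 0 := by positivity
  have hN : ∀ x : EuclideanSpace ℝ (Fin n),
      ‖x - y‖ ^ 2 + ε = (∑ j, (x j - y j) * (x j - y j)) + ε := by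
    intro x
    rw [EuclideanSpace.norm_sq_eq]
    simp [pow_two]
  have hr := Real.hasDerivAt_rpow_const (x := ‖x - y‖ ^ 2 + ε) (p := a) (Or.inl hpos)
  have hd : DifferentiableAt ℝ (fun x : EuclideanSpace ℝ (Fin n) => ‖x - y‖ ^ 2 + ε) x :=
    ((differentiableAt_id.sub_const y).norm_sq ℝ).add_const ε
  rw [pderiv_comp (h := fun t => t ^ a) (f := fun x => ‖x - y‖ ^ 2 + ε) i hr.differentiableAt hd,
    hr.deriv]
  have hc : ∀ j : Fin n, DifferentiableAt ℝ (fun x : EuclideanSpace ℝ (Fin n) => x j - y j) x :=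
    fun j => by fun_prop
  have : pderiv i (fun x => ‖x - y‖ ^ 2 + ε) x = 2 * (x i - y i) := by
    have h0 : pderiv i (fun _ : EuclideanSpace ℝ (Fin n) => ε) x = 0 := by simp [pderiv]
    simp_rw [hN]
    rw [pderiv_add i (DifferentiableAt.fun_sum fun j _ => (hc j).fun_mul (hc j)) (by fun_prop), h0,
      pderiv_sum _ _ fun j _ => (hc j).fun_mul (hc j)]
    simp_rw [pderiv_mul i (hc _) (hc _), pderiv_coord]
    simp [Finset.sum_add_distrib]
    ring
  rw [this]
  ring

lemma contDiff_rpow_norm_sq_add {ε : ℝ} (hε : 0 < ε) (a : ℝ) (y : EuclideanSpace ℝ (Fin n)) :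
    ContDiff ℝ (⊤ : ℕ∞) fun x => (‖x - y‖ ^ 2 + ε) ^ a :=
  (((contDiff_id.sub contDiff_const).norm_sq ℝ).add contDiff_const).rpow_const_of_ne
    fun x => by positivity

/-- Regularized Hardy inequality on the level sets of `u`, with pole `y`. -/
lemma integral_hardy_regularized (hn : 2 ≤ n) (hΩ : IsOpen Ω) (hΩb : IsBounded Ω)
    (hu : ContDiff ℝ (⊤ : ℕ∞) u) (hb : ∀ x ∈ frontier Ω, u x = 0) (hδ : 0 < δ)
    (h0 : ∀ t ≤ δ, h t = 0) (hh : ContDiff ℝ (⊤ : ℕ∞) h) (hpos : ∀ t, 0 ≤ h t)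
    (y : EuclideanSpace ℝ (Fin n)) {ε : ℝ} (hε : 0 < ε) :
    IntegrableOn (fun x => h (u x) * (‖x - y‖ ^ 2 + ε) ^ (-((n : ℝ) - 2) / 2) * gradSq u x) Ω ∧
    IntegrableOn (fun x => h (u x) * (‖x - y‖ ^ 2 + ε) ^ (-((n : ℝ) - 2) / 2) *
        (‖x - y‖ ^ 2 * tangHess u x)) Ω ∧
    ∫ x in Ω, h (u x) * (‖x - y‖ ^ 2 + ε) ^ (-((n : ℝ) - 2) / 2) * gradSq u x ≤
      2 * (n + 1) * ∫ x in Ω, h (u x) * (‖x - y‖ ^ 2 + ε) ^ (-((n : ℝ) - 2) / 2) *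
        (‖x - y‖ ^ 2 * tangHess u x) := by
  set a : ℝ := -((n : ℝ) - 2) / 2 with ha
  set ψ : EuclideanSpace ℝ (Fin n) → ℝ := fun x => (‖x - y‖ ^ 2 + ε) ^ a with hψ
  set q : EuclideanSpace ℝ (Fin n) → ℝ := fun x => ∑ i, pderiv i u x * (x i - y i) with hq
  set θ := Ω.indicator fun y => h (u y) with hθ
  have hB : ∀ x, 0 < ‖x - y‖ ^ 2 + ε := fun x => by positivity
  have hψ0 : ∀ x, 0 < ψ x := fun x => Real.rpow_pos_of_pos (hB x) _
  have hθs : ContDiff ℝ (⊤ : ℕ∞) θ := contDiff_indicator_comp hΩ hu hb hδ h0 hh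
  have hψs : ContDiff ℝ (⊤ : ℕ∞) ψ := contDiff_rpow_norm_sq_add hε a y
  have hPs := contDiff_gradSq hu
  have hzs : ∀ i : Fin n, ContDiff ℝ (⊤ : ℕ∞) fun x : EuclideanSpace ℝ (Fin n) => x i - y i :=
    fun i => by fun_prop
  have hqs : ContDiff ℝ (⊤ : ℕ∞) q := ContDiff.sum fun i _ => (hu.pderiv i).mul (hzs i)
  have hθc : HasCompactSupport θ := hasCompactSupport_indicator hΩb _
  set V : Fin n → EuclideanSpace ℝ (Fin n) → ℝ := fun i x =>
    gradSq u x * (x i - y i) - q x * pderiv i u x with hV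
  have hVs : ∀ i, ContDiff ℝ (⊤ : ℕ∞) (V i) := fun i =>
    (hPs.mul (hzs i)).sub (hqs.mul (hu.pderiv i))
  have hYs : ∀ i, ContDiff ℝ (⊤ : ℕ∞) fun x => θ x * (ψ x * V i x) := fun i =>
    hθs.mul (hψs.mul (hVs i))
  have hYc : ∀ i, HasCompactSupport fun x => θ x * (ψ x * V i x) := fun i => hθc.mul_right
  have hdθ : ∀ i x, pderiv i θ x = Ω.indicator (fun y => deriv h (u y)) x * pderiv i u x :=
    fun i x => pderiv_indicator_comp hΩ hu hb hδ h0 hh i x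
  have hdY : ∀ i x, pderiv i (fun x => θ x * (ψ x * V i x)) x =
      pderiv i θ x * (ψ x * V i x) + θ x * (pderiv i ψ x * V i x + ψ x * pderiv i (V i) x) := by
    intro i x
    have d1 := hθs.differentiable (by simp) x
    have d2 := hψs.differentiable (by simp) x
    have d3 := (hVs i).differentiable (by simp) x
    rw [pderiv_mul i d1 (d2.fun_mul d3), pderiv_mul i d2 d3]
  have hdiv := setIntegral_sum_pderiv_eq_zero (Ω := Ω) (fun i => (hYs i).of_le (by simp)) hYc
    (fun i x hx => by rw [hdY, hdθ]; simp [hθ, hx])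
  have hdq : ∀ i x, pderiv i q x =
      ∑ j, pderiv i (pderiv j u) x * (x j - y j) + pderiv i u x := by
    intro i x
    have d1 : ∀ j, DifferentiableAt ℝ (pderiv j u) x := fun j =>
      (hu.pderiv j).differentiable (by simp) x
    have d2 : ∀ j : Fin n, DifferentiableAt ℝ (fun x : EuclideanSpace ℝ (Fin n) => x j - y j) x :=
      fun j => (hzs j).differentiable (by simp) x
    rw [hq, pderiv_sum _ _ fun j _ => (d1 j).fun_mul (d2 j)]
    simp_rw [pderiv_mul i (d1 _) (d2 _), pderiv_coord]
    simp [Finset.sum_add_distrib]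
  have hdV : ∀ i x, pderiv i (V i) x = 2 * (hessGrad u i x * (x i - y i)) + gradSq u x
      - (∑ j, pderiv i (pderiv j u) x * (x j - y j)) * pderiv i u x - pderiv i u x ^ 2
      - q x * pderiv i (pderiv i u) x := by
    intro i x
    have d1 := hPs.differentiable (by simp) x
    have d2 := (hzs i).differentiable (by simp) x
    have d3 := hqs.differentiable (by simp) x
    have d4 := (hu.pderiv i).differentiable (by simp) x
    rw [hV, pderiv_sub i (d1.fun_mul d2) (d3.fun_mul d4), pderiv_mul i d1 d2, pderiv_mul i d3 d4,
      hdq, pderiv_gradSq hu, pderiv_coord]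
    simp
    ring
  have hz2 : ∀ x, ∑ i, (x i - y i) ^ 2 = ‖x - y‖ ^ 2 := fun x => by
    simp [EuclideanSpace.norm_sq_eq]
  have hpV : ∀ x, ∑ i, pderiv i u x * V i x = 0 := by
    intro x
    have : ∀ i, pderiv i u x * V i x =
        gradSq u x * (pderiv i u x * (x i - y i)) - q x * pderiv i u x ^ 2 := fun i => by
      simp only [hV]; ring
    simp_rw [this, Finset.sum_sub_distrib, ← Finset.mul_sum]
    change gradSq u x * q x - q x * gradSq u x = 0
    ring
  have hzV : ∀ x, ∑ i, (x i - y i) * V i x = gradSq u x * ‖x - y‖ ^ 2 - q x ^ 2 := by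
    intro x
    have : ∀ i, (x i - y i) * V i x =
        gradSq u x * (x i - y i) ^ 2 - q x * (pderiv i u x * (x i - y i)) := fun i => by
      simp only [hV]; ring
    simp_rw [this, Finset.sum_sub_distrib, ← Finset.mul_sum, hz2]
    change _ - q x * q x = _
    ring
  have hsumV : ∀ x, ∑ i, pderiv i (V i) x =
      (∑ i, hessGrad u i x * (x i - y i) - q x * lap u x) + (n - 1) * gradSq u x := by
    intro x
    have hsw : ∑ i, (∑ j, pderiv i (pderiv j u) x * (x j - y j)) * pderiv i u x =
        ∑ i, hessGrad u i x * (x i - y i) := by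
      simp_rw [hessGrad, Finset.sum_mul]
      rw [Finset.sum_comm]
      refine Finset.sum_congr rfl fun i _ => Finset.sum_congr rfl fun j _ => ?_
      rw [pderiv_comm i j hu]
      ring
    simp_rw [hdV, Finset.sum_sub_distrib, Finset.sum_add_distrib, hsw, ← Finset.mul_sum,
      ← lap_eq hu]
    change 2 * _ + _ - _ - gradSq u x - _ = _
    simp
    ring
  have hlow : ∀ x ∈ Ω, h (u x) * ψ x * gradSq u x / 2
      - (n + 1) * (h (u x) * ψ x * (‖x - y‖ ^ 2 * tangHess u x)) ≤
      ∑ i, pderiv i (fun x => θ x * (ψ x * V i x)) x := by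
    intro x hx
    have hθx : θ x = h (u x) := by simp [hθ, hx]
    have hdψ : ∀ i, pderiv i ψ x = 2 * a * (‖x - y‖ ^ 2 + ε) ^ (a - 1) * (x i - y i) := fun i =>
      pderiv_rpow_norm_sq_add hε a i x y
    have hterm : ∀ i, pderiv i (fun x => θ x * (ψ x * V i x)) x =
        deriv h (u x) * ψ x * (pderiv i u x * V i x) + (h (u x) *
          (2 * a * (‖x - y‖ ^ 2 + ε) ^ (a - 1)) * ((x i - y i) * V i x)
          + h (u x) * ψ x * pderiv i (V i) x) := by
      intro i
      rw [hdY, hdθ, hdψ, hθx]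
      simp only [hx, Set.indicator_of_mem]
      ring
    simp_rw [hterm, Finset.sum_add_distrib, ← Finset.mul_sum, hpV, hzV, hsumV]
    have hψB : ψ x = (‖x - y‖ ^ 2 + ε) ^ (a - 1) * (‖x - y‖ ^ 2 + ε) := by
      rw [← Real.rpow_add_one (hB x).ne']
      simp [hψ]
    have h1 := neg_le_of_abs_le (hessGrad_sub_lap_le hu x y)
    change -_ ≤ _ - q x * lap u x at h1
    have h2 : (‖x - y‖ ^ 2 + ε) ^ (a - 1) * (gradSq u x * ‖x - y‖ ^ 2 - q x ^ 2) ≤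
        ψ x * gradSq u x := by
      have : 0 < (‖x - y‖ ^ 2 + ε) ^ (a - 1) := Real.rpow_pos_of_pos (hB x) _
      rw [hψB, mul_assoc]
      refine mul_le_mul_of_nonneg_left ?_ this.le
      nlinarith [sq_nonneg (q x), mul_nonneg hε.le (gradSq_nonneg (u := u) (x := x))]
    have h3 : 0 ≤ h (u x) * ψ x := mul_nonneg (hpos _) (hψ0 x).le
    have h4 := mul_le_mul_of_nonneg_left h1 h3
    have h2a : 2 * a = -((n : ℝ) - 2) := by rw [ha]; ring
    have hn2 : (0 : ℝ) ≤ (n : ℝ) - 2 := by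
      have : (2 : ℝ) ≤ n := by exact_mod_cast hn
      linarith
    have h5 := mul_le_mul_of_nonneg_left h2 (mul_nonneg (hpos (u x)) hn2)
    rw [h2a]
    linarith
  have hcP := hPs.continuous
  have hch : Continuous fun x => h (u x) := hh.continuous.comp hu.continuous
  have hcψ := hψs.continuous
  have hcH := continuous_hessSq hu
  have i1 : IntegrableOn (fun x => h (u x) * ψ x * gradSq u x) Ω :=
    integrableOn_of_continuous hΩb (by fun_prop)
  have i2 : IntegrableOn (fun x => h (u x) * ψ x * (‖x - y‖ ^ 2 * tangHess u x)) Ω := by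
    have i2' : IntegrableOn (fun x => h (u x) * ψ x * (‖x - y‖ ^ 2 * hessSq u x)) Ω :=
      integrableOn_of_continuous hΩb (by fun_prop)
    refine Integrable.mono' i2' (((hch.mul hcψ).measurable.mul
      ((by fun_prop : Continuous fun x => ‖x - y‖ ^ 2).measurable.mul
        (measurable_tangHess hu))).aestronglyMeasurable) (Eventually.of_forall fun x => ?_)
    have h3 : 0 ≤ h (u x) * ψ x := mul_nonneg (hpos _) (hψ0 x).le
    have h4 := tangHess_nonneg (u := u) (x := x)
    rw [Real.norm_of_nonneg (by positivity)]
    gcongr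
    exact tangHess_le_hessSq
  refine ⟨i1, i2, ?_⟩
  have i3 : IntegrableOn (fun x => ∑ i, pderiv i (fun x => θ x * (ψ x * V i x)) x) Ω :=
    integrable_finsetSum _ fun i _ =>
      (integrable_pderiv i ((hYs i).of_le (by simp)) (hYc i)).integrableOn
  have hfin := setIntegral_mono_on ((i1.div_const 2).sub (i2.const_mul ((n : ℝ) + 1))) i3
    hΩ.measurableSet hlow
  have hsub := integral_sub (i1.div_const 2) (i2.const_mul ((n : ℝ) + 1))
  simp only [Pi.sub_apply] at hfin
  rw [hdiv, hsub, integral_div, integral_const_mul] at hfin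
  linarith

/-- Hardy inequality on the level sets of `u`, with pole `y` and a weight `h(u)`. -/
lemma lintegral_hardy (hn : 5 ≤ n) (hΩ : IsOpen Ω) (hΩb : IsBounded Ω)
    (hu : ContDiff ℝ (⊤ : ℕ∞) u) (hb : ∀ x ∈ frontier Ω, u x = 0) (hδ : 0 < δ)
    (h0 : ∀ t ≤ δ, h t = 0) (hh : ContDiff ℝ (⊤ : ℕ∞) h) (hpos : ∀ t, 0 ≤ h t)
    (y : EuclideanSpace ℝ (Fin n)) :
    ∫⁻ x in Ω, ENNReal.ofReal (h (u x) * gradSq u x * ‖x - y‖ ^ (2 - (n : ℝ))) ≤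
      ENNReal.ofReal (2 * (n + 1)) *
        ∫⁻ x in Ω, ENNReal.ofReal (h (u x) * tangHess u x * ‖x - y‖ ^ (4 - (n : ℝ))) := by
  have hn5 : (5 : ℝ) ≤ n := by exact_mod_cast hn
  set a : ℝ := -((n : ℝ) - 2) / 2 with ha
  have hbound : ∀ ε : ℝ, 0 < ε →
      ∫⁻ x in Ω, ENNReal.ofReal (h (u x) * (‖x - y‖ ^ 2 + ε) ^ a * gradSq u x) ≤
      ENNReal.ofReal (2 * (n + 1)) *
        ∫⁻ x in Ω, ENNReal.ofReal (h (u x) * tangHess u x * ‖x - y‖ ^ (4 - (n : ℝ))) := by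
    intro ε hε
    obtain ⟨i1, i2, hle⟩ := integral_hardy_regularized (by omega) hΩ hΩb hu hb hδ h0 hh hpos y hε
    have hB : ∀ x, 0 < ‖x - y‖ ^ 2 + ε := fun x => by positivity
    rw [← ofReal_integral_eq_lintegral_ofReal i1 (Eventually.of_forall fun x =>
      mul_nonneg (mul_nonneg (hpos _) (Real.rpow_nonneg (hB x).le _)) gradSq_nonneg)]
    refine (ENNReal.ofReal_le_ofReal hle).trans ?_
    rw [ENNReal.ofReal_mul (by positivity), ofReal_integral_eq_lintegral_ofReal i2
      (Eventually.of_forall fun x => mul_nonneg (mul_nonneg (hpos _)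
        (Real.rpow_nonneg (hB x).le _)) (mul_nonneg (sq_nonneg _) tangHess_nonneg))]
    refine mul_le_mul' le_rfl (lintegral_mono fun x => ENNReal.ofReal_le_ofReal ?_)
    rcases (norm_nonneg (x - y)).eq_or_lt with hz | hz
    · rw [← hz]
      simp only [ne_eq, OfNat.ofNat_ne_zero, not_false_eq_true, zero_pow, zero_mul, mul_zero]
      exact mul_nonneg (mul_nonneg (hpos _) tangHess_nonneg) (Real.rpow_nonneg le_rfl _)
    · have hle1 : (‖x - y‖ ^ 2 + ε) ^ a ≤ ‖x - y‖ ^ (2 - (n : ℝ)) := by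
        have h1 : ‖x - y‖ ^ (2 - (n : ℝ)) = (‖x - y‖ ^ 2) ^ a := by
          rw [← Real.rpow_natCast, ← Real.rpow_mul hz.le]
          congr 1
          rw [ha]; push_cast; ring
        rw [h1]
        exact Real.rpow_le_rpow_of_nonpos (by positivity) (by linarith) (by rw [ha]; linarith)
      have h2 : ‖x - y‖ ^ (4 - (n : ℝ)) = ‖x - y‖ ^ (2 - (n : ℝ)) * ‖x - y‖ ^ 2 := by
        rw [← Real.rpow_natCast, ← Real.rpow_add hz]
        congr 1
        push_cast; ring
      rw [h2]
      have h3 := hpos (u x)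
      have h4 := tangHess_nonneg (u := u) (x := x)
      calc h (u x) * (‖x - y‖ ^ 2 + ε) ^ a * (‖x - y‖ ^ 2 * tangHess u x)
          ≤ h (u x) * ‖x - y‖ ^ (2 - (n : ℝ)) * (‖x - y‖ ^ 2 * tangHess u x) := by gcongr
        _ = _ := by ring
  have hεj : ∀ j : ℕ, (0 : ℝ) < 1 / ((j : ℝ) + 1) := fun j => by positivity
  have hmeas : ∀ j : ℕ, Measurable fun x => ENNReal.ofReal
      (h (u x) * (‖x - y‖ ^ 2 + 1 / ((j : ℝ) + 1)) ^ a * gradSq u x) := fun j =>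
    (((hh.continuous.comp hu.continuous).mul
      (contDiff_rpow_norm_sq_add (hεj j) a y).continuous).mul
      (contDiff_gradSq hu).continuous).measurable.ennreal_ofReal
  calc ∫⁻ x in Ω, ENNReal.ofReal (h (u x) * gradSq u x * ‖x - y‖ ^ (2 - (n : ℝ)))
      ≤ ∫⁻ x in Ω, liminf (fun j : ℕ => ENNReal.ofReal
          (h (u x) * (‖x - y‖ ^ 2 + 1 / ((j : ℝ) + 1)) ^ a * gradSq u x)) atTop := by
        refine lintegral_mono fun x => ?_
        rcases (norm_nonneg (x - y)).eq_or_lt with hz | hz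
        · rw [← hz, Real.zero_rpow (by linarith)]
          simp
        · have h1 : ‖x - y‖ ^ (2 - (n : ℝ)) = (‖x - y‖ ^ 2 + 0) ^ a := by
            rw [add_zero, ← Real.rpow_natCast, ← Real.rpow_mul hz.le]
            congr 1
            rw [ha]; push_cast; ring
          have h2 : Tendsto (fun j : ℕ => ENNReal.ofReal
              (h (u x) * (‖x - y‖ ^ 2 + 1 / ((j : ℝ) + 1)) ^ a * gradSq u x)) atTop
              (𝓝 (ENNReal.ofReal (h (u x) * (‖x - y‖ ^ 2 + 0) ^ a * gradSq u x))) := by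
            refine ENNReal.tendsto_ofReal (Tendsto.mul_const _ (Tendsto.const_mul _ ?_))
            refine Tendsto.rpow_const (tendsto_const_nhds.add
              tendsto_one_div_add_atTop_nhds_zero_nat) (Or.inl ?_)
            positivity
          rw [h2.liminf_eq, h1]
          exact le_of_eq (congrArg _ (by ring))
    _ ≤ liminf (fun j : ℕ => ∫⁻ x in Ω, ENNReal.ofReal
          (h (u x) * (‖x - y‖ ^ 2 + 1 / ((j : ℝ) + 1)) ^ a * gradSq u x)) atTop :=
        lintegral_liminf_le hmeas
    _ ≤ _ := by
        refine (liminf_le_liminf (Eventually.of_forall fun j => hbound _ (hεj j))).trans_eq ?_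
        simp

end Hardy

section Kernel

variable {n : ℕ}

lemma lintegral_comp_smul_eq {f : EuclideanSpace ℝ (Fin n) → ℝ≥0∞} (hf : Measurable f) {t : ℝ}
    (ht : 0 < t) :
    ∫⁻ z, f (t • z) = ENNReal.ofReal (t ^ (-(n : ℝ))) * ∫⁻ z, f z := by
  have h := lintegral_map (μ := volume) hf (measurable_const_smul t)
  rw [← h, Measure.map_addHaar_smul volume ht.ne', lintegral_smul_measure,
    finrank_euclideanSpace_fin, abs_of_pos (by positivity), Real.rpow_neg ht.le,
    Real.rpow_natCast, smul_eq_mul]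

/-- The mass of `|z|^{-α}` in the unit ball. -/
noncomputable def kernelMass (n : ℕ) (α : ℝ) : ℝ≥0∞ :=
  ∫⁻ z in Metric.ball (0 : EuclideanSpace ℝ (Fin n)) 1, ENNReal.ofReal (‖z‖ ^ (-α))

lemma kernelMass_lt_top {α : ℝ} (hn : 1 ≤ n) (hα : α < n) : kernelMass n α < ∞ := by
  have h := integrableOn_ball_of_norm_le_rpow (μ := volume) (E := EuclideanSpace ℝ (Fin n))
    (f := fun z => ‖z‖ ^ (-α)) (C := 1) (α := α) (r := 1) (by simpa using hn) (by simpa using hα)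
    (Eventually.of_forall fun x => by
      rw [one_mul, Real.norm_of_nonneg (Real.rpow_nonneg (norm_nonneg _) _)])
    (measurable_norm.pow_const _).aestronglyMeasurable
  exact h.lintegral_lt_top

lemma lintegral_ball_kernel (α : ℝ) (x : EuclideanSpace ℝ (Fin n)) {ρ : ℝ} (hρ : 0 < ρ) :
    ∫⁻ y in Metric.ball x ρ, ENNReal.ofReal (‖x - y‖ ^ (-α)) =
      kernelMass n α * ENNReal.ofReal (ρ ^ ((n : ℝ) - α)) := by
  have hm : Measurable fun z : EuclideanSpace ℝ (Fin n) => ENNReal.ofReal (‖z‖ ^ (-α)) :=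
    (measurable_norm.pow_const _).ennreal_ofReal
  have h1 : ∫⁻ y in Metric.ball x ρ, ENNReal.ofReal (‖x - y‖ ^ (-α)) =
      ∫⁻ z, (Metric.ball (0 : EuclideanSpace ℝ (Fin n)) ρ).indicator
        (fun z => ENNReal.ofReal (‖z‖ ^ (-α))) z := by
    rw [← lintegral_indicator Metric.isOpen_ball.measurableSet,
      ← lintegral_sub_left_eq_self _ x]
    refine lintegral_congr fun y => ?_
    by_cases hy : ‖y‖ < ρ
    · simp [Set.indicator, hy]
    · simp [Set.indicator, hy]
  have h2 := lintegral_comp_smul_eq (hm.indicator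
    (Metric.isOpen_ball (x := (0 : EuclideanSpace ℝ (Fin n))) (ε := ρ)).measurableSet) hρ
  have h3 : ∫⁻ z, (Metric.ball (0 : EuclideanSpace ℝ (Fin n)) ρ).indicator
        (fun z => ENNReal.ofReal (‖z‖ ^ (-α))) (ρ • z) =
      ENNReal.ofReal (ρ ^ (-α)) * kernelMass n α := by
    rw [kernelMass, ← lintegral_indicator Metric.isOpen_ball.measurableSet,
      ← lintegral_const_mul _ (hm.indicator Metric.isOpen_ball.measurableSet)]
    refine lintegral_congr fun z => ?_
    by_cases hz : ‖z‖ < 1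
    · have : |ρ| * ‖z‖ < ρ := by
        rw [abs_of_pos hρ]; nlinarith
      simp only [Set.indicator, Metric.mem_ball, dist_zero_right, norm_smul, Real.norm_eq_abs,
        this, hz, if_true]
      rw [abs_of_pos hρ, Real.mul_rpow hρ.le (norm_nonneg _), ENNReal.ofReal_mul (by positivity)]
    · have : ¬ |ρ| * ‖z‖ < ρ := by
        rw [abs_of_pos hρ]; nlinarith
      simp [Set.indicator, norm_smul, this, hz]
  rw [h3] at h2
  have h4 : ENNReal.ofReal (ρ ^ (n : ℝ)) * ENNReal.ofReal (ρ ^ (-(n : ℝ))) = 1 := by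
    rw [← ENNReal.ofReal_mul (by positivity), ← Real.rpow_add hρ]
    simp
  rw [h1]
  calc _ = ENNReal.ofReal (ρ ^ (n : ℝ)) * ENNReal.ofReal (ρ ^ (-(n : ℝ))) * _ := by
        rw [h4, one_mul]
    _ = ENNReal.ofReal (ρ ^ (n : ℝ)) * (ENNReal.ofReal (ρ ^ (-α)) * kernelMass n α) := by
        rw [mul_assoc, ← h2]
    _ = _ := by
        rw [← mul_assoc, ← ENNReal.ofReal_mul (by positivity), ← Real.rpow_add hρ, mul_comm]
        rfl

lemma lintegral_Ioi_rpow (hn : 1 ≤ n) {c : ℝ} (hc : 0 < c) :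
    ∫⁻ t in Set.Ioi c, ENNReal.ofReal (t ^ (-(n : ℝ) - 1)) ≤ ENNReal.ofReal (c ^ (-(n : ℝ))) := by
  have hn1 : (1 : ℝ) ≤ n := by exact_mod_cast hn
  have hlt : -(n : ℝ) - 1 < -1 := by linarith
  rw [← ofReal_integral_eq_lintegral_ofReal (integrableOn_Ioi_rpow_of_lt hlt hc)
    ((ae_restrict_iff' measurableSet_Ioi).2 (Eventually.of_forall fun t ht =>
      Real.rpow_nonneg (hc.le.trans (le_of_lt ht)) _)), integral_Ioi_rpow_of_lt hlt hc]
  refine ENNReal.ofReal_le_ofReal ?_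
  have h0 : 0 ≤ c ^ (-(n : ℝ)) := by positivity
  rw [sub_add_cancel, neg_div_neg_eq]
  exact div_le_self h0 hn1

lemma enorm_le_lintegral_ray {F : EuclideanSpace ℝ (Fin n) → ℝ} (hF : ContDiff ℝ 1 F)
    (hFc : HasCompactSupport F) (y z : EuclideanSpace ℝ (Fin n)) (hz : z ≠ 0) :
    ‖F y‖ₑ ≤ ∫⁻ t in Set.Ioi (0 : ℝ), ‖fderiv ℝ F (y + t • z)‖ₑ * ‖z‖ₑ := by
  set f : ℝ → ℝ := fun t => F (y - t • z) with hf
  have hfs : ContDiff ℝ 1 f := hF.comp (by fun_prop)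
  have hfd : ∀ t, HasDerivAt f (fderiv ℝ F (y - t • z) (-z)) t := by
    intro t
    have h1 : HasDerivAt (fun t : ℝ => y - t • z) (-z) t := by
      simpa using ((hasDerivAt_id t).smul_const z).const_sub y
    exact (hF.differentiable (by simp) _).hasFDerivAt.comp_hasDerivAt t h1
  have hfc : HasCompactSupport f := by
    obtain ⟨R, hR⟩ := hFc.isBounded.subset_closedBall (0 : EuclideanSpace ℝ (Fin n))
    have hz0 : 0 < ‖z‖ := norm_pos_iff.2 hz
    refine HasCompactSupport.intro (K := Set.Icc (-((R + ‖y‖) / ‖z‖)) ((R + ‖y‖) / ‖z‖))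
      isCompact_Icc fun t ht => ?_
    by_contra hne
    have h1 : y - t • z ∈ Metric.closedBall (0 : EuclideanSpace ℝ (Fin n)) R :=
      hR (subset_tsupport _ hne)
    have h2 : ‖t • z‖ ≤ ‖y - t • z‖ + ‖y‖ := by
      have := norm_sub_le y (y - t • z)
      rw [sub_sub_cancel] at this
      linarith
    rw [mem_closedBall_zero_iff] at h1
    rw [norm_smul, Real.norm_eq_abs] at h2
    refine ht (abs_le.1 ?_)
    rw [le_div_iff₀ hz0]
    linarith
  have h1 := HasCompactSupport.enorm_le_lintegral_Ici_deriv hfs hfc 0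
  have h2 : f 0 = F y := by simp [hf]
  rw [h2] at h1
  refine h1.trans ?_
  have hmp := (Measure.measurePreserving_neg (volume : Measure ℝ)).setLIntegral_comp_preimage_emb
    (MeasurableEquiv.neg ℝ).measurableEmbedding (fun t => ‖deriv f t‖ₑ) (Set.Iic 0)
  rw [← hmp]
  have hs : (Neg.neg ⁻¹' Set.Iic (0 : ℝ)) = Set.Ici 0 := by ext t; simp
  rw [hs, restrict_Ioi_eq_restrict_Ici]
  refine lintegral_mono fun t => ?_
  rw [(hfd _).deriv, neg_smul, sub_neg_eq_add]
  refine ((fderiv ℝ F (y + t • z)).le_opENorm _).trans_eq ?_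
  rw [enorm_neg]

lemma setLIntegral_ball_comp_smul {G : EuclideanSpace ℝ (Fin n) → ℝ≥0∞} (hG : Measurable G)
    {t : ℝ} (ht : 0 < t) :
    ∫⁻ z in Metric.ball (0 : EuclideanSpace ℝ (Fin n)) 1, G (t • z) * ‖z‖ₑ =
      ∫⁻ w, (Set.Ioi ‖w‖).indicator
        (fun t => G w * ‖w‖ₑ * ENNReal.ofReal (t ^ (-(n : ℝ) - 1))) t := by
  set H : EuclideanSpace ℝ (Fin n) → ℝ≥0∞ := (Metric.ball 0 t).indicator fun w => G w * ‖w‖ₑ with hH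
  have hHm : Measurable H :=
    (hG.mul measurable_enorm).indicator Metric.isOpen_ball.measurableSet
  have hHt : Measurable fun z => H (t • z) := hHm.comp (measurable_const_smul t)
  have hr : ENNReal.ofReal (t ^ (-(n : ℝ))) * ENNReal.ofReal (t ^ (-(1 : ℝ))) =
      ENNReal.ofReal (t ^ (-(n : ℝ) - 1)) := by
    rw [← ENNReal.ofReal_mul (by positivity), ← Real.rpow_add ht, ← sub_eq_add_neg]
  have h1 : ∀ w, (Set.Ioi ‖w‖).indicator
      (fun t => G w * ‖w‖ₑ * ENNReal.ofReal (t ^ (-(n : ℝ) - 1))) t =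
      ENNReal.ofReal (t ^ (-(n : ℝ) - 1)) * H w := by
    intro w
    by_cases hw : ‖w‖ < t
    · rw [Set.indicator_of_mem (Set.mem_Ioi.2 hw), hH,
        Set.indicator_of_mem (mem_ball_zero_iff.2 hw), mul_comm]
    · rw [Set.indicator_of_notMem (by simpa using hw), hH,
        Set.indicator_of_notMem (by simpa using hw), mul_zero]
  have h2 : ∀ z, (Metric.ball (0 : EuclideanSpace ℝ (Fin n)) 1).indicator
      (fun z => G (t • z) * ‖z‖ₑ) z = ENNReal.ofReal (t ^ (-(1 : ℝ))) * H (t • z) := by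
    intro z
    have hn : ‖t • z‖ = t * ‖z‖ := by rw [norm_smul, Real.norm_of_nonneg ht.le]
    have he : ‖t • z‖ₑ = ENNReal.ofReal t * ‖z‖ₑ := by
      rw [enorm_smul, Real.enorm_of_nonneg ht.le]
    have h3 : ENNReal.ofReal (t ^ (-(1 : ℝ))) * ENNReal.ofReal t = 1 := by
      rw [← ENNReal.ofReal_mul (by positivity), ← Real.rpow_add_one ht.ne']
      simp
    by_cases hz : ‖z‖ < 1
    · have hz' : ‖t • z‖ < t := by rw [hn]; nlinarith
      rw [Set.indicator_of_mem (mem_ball_zero_iff.2 hz), hH,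
        Set.indicator_of_mem (mem_ball_zero_iff.2 hz'), he, mul_left_comm (G (t • z)), ← mul_assoc,
        h3, one_mul]
    · have hz' : ¬ ‖t • z‖ < t := by rw [hn]; nlinarith
      rw [Set.indicator_of_notMem (by simpa using hz), hH,
        Set.indicator_of_notMem (by rwa [mem_ball_zero_iff]), mul_zero]
  rw [← lintegral_indicator Metric.isOpen_ball.measurableSet, lintegral_congr h2,
    lintegral_congr h1, lintegral_const_mul _ hHm,
    lintegral_const_mul _ hHt, lintegral_comp_smul_eq hHm ht,
    ← hr, ← mul_assoc, mul_comm (ENNReal.ofReal (t ^ (-(1 : ℝ))))]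

/-- Pointwise bound of a compactly supported function by the Riesz potential of its gradient. -/
lemma volume_ball_mul_enorm_le (hn : 1 ≤ n) {F : EuclideanSpace ℝ (Fin n) → ℝ}
    (hF : ContDiff ℝ 1 F) (hFc : HasCompactSupport F) (y : EuclideanSpace ℝ (Fin n)) :
    volume (Metric.ball (0 : EuclideanSpace ℝ (Fin n)) 1) * ‖F y‖ₑ ≤
      ∫⁻ x, ‖fderiv ℝ F x‖ₑ * ENNReal.ofReal (‖x - y‖ ^ (1 - (n : ℝ))) := by
  have hn1 : (1 : ℝ) ≤ n := by exact_mod_cast hn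
  have : Nonempty (Fin n) := ⟨⟨0, hn⟩⟩
  set B := Metric.ball (0 : EuclideanSpace ℝ (Fin n)) 1 with hB
  have hBm : MeasurableSet B := Metric.isOpen_ball.measurableSet
  set G : EuclideanSpace ℝ (Fin n) → ℝ≥0∞ := fun w => ‖fderiv ℝ F (y + w)‖ₑ with hG
  have hGm : Measurable G := ((hF.continuous_fderiv (by simp)).comp
    (continuous_const.add continuous_id)).enorm.measurable
  set A : ℝ → EuclideanSpace ℝ (Fin n) → ℝ≥0∞ := fun t w =>
    (Set.Ioi ‖w‖).indicator (fun t => G w * ‖w‖ₑ * ENNReal.ofReal (t ^ (-(n : ℝ) - 1))) t with hA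
  have hAm : Measurable (Function.uncurry A) := by
    have : Function.uncurry A = {p : ℝ × EuclideanSpace ℝ (Fin n) | ‖p.2‖ < p.1}.indicator
        fun p => G p.2 * ‖p.2‖ₑ * ENNReal.ofReal (p.1 ^ (-(n : ℝ) - 1)) := by
      ext ⟨t, w⟩
      simp [A, Function.uncurry, Set.indicator]
    rw [this]
    refine Measurable.indicator ?_ (measurableSet_lt (by fun_prop) (by fun_prop))
    exact ((hGm.comp measurable_snd).mul measurable_snd.enorm).mul
      (measurable_fst.pow_const _).ennreal_ofReal
  calc volume B * ‖F y‖ₑ = ∫⁻ z in B, ‖F y‖ₑ := by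
        rw [setLIntegral_const, mul_comm]
    _ ≤ ∫⁻ z in B, ∫⁻ t in Set.Ioi (0 : ℝ), G (t • z) * ‖z‖ₑ := by
        refine lintegral_mono_ae (ae_restrict_of_ae ?_)
        filter_upwards [Measure.ae_ne volume (0 : EuclideanSpace ℝ (Fin n))] with z hz
        exact enorm_le_lintegral_ray hF hFc y z hz
    _ = ∫⁻ t in Set.Ioi (0 : ℝ), ∫⁻ z in B, G (t • z) * ‖z‖ₑ := by
        refine lintegral_lintegral_swap (Measurable.aemeasurable ?_)
        exact (hGm.comp (measurable_snd.smul measurable_fst)).mul measurable_fst.enorm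
    _ ≤ ∫⁻ t in Set.Ioi (0 : ℝ), ∫⁻ w, A t w := by
        exact setLIntegral_mono' measurableSet_Ioi fun t ht =>
          (setLIntegral_ball_comp_smul hGm ht).le
    _ ≤ ∫⁻ t, ∫⁻ w, A t w := setLIntegral_le_lintegral _ _
    _ = ∫⁻ w, ∫⁻ t, A t w := lintegral_lintegral_swap hAm.aemeasurable
    _ ≤ ∫⁻ w, G w * ENNReal.ofReal (‖w‖ ^ (1 - (n : ℝ))) := by
        refine lintegral_mono fun w => ?_
        simp only [hA]
        rw [lintegral_indicator measurableSet_Ioi]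
        rcases eq_or_ne w 0 with rfl | hw
        · simp
        have hw0 : 0 < ‖w‖ := norm_pos_iff.2 hw
        rw [lintegral_const_mul _ (by fun_prop), mul_assoc]
        refine mul_le_mul' le_rfl ((mul_le_mul' le_rfl (lintegral_Ioi_rpow hn hw0)).trans_eq ?_)
        rw [← ofReal_norm, ← ENNReal.ofReal_mul hw0.le, mul_comm, ← Real.rpow_add_one hw0.ne']
        congr 2
        ring
    _ = _ := by
        rw [← lintegral_sub_right_eq_self _ y]
        refine lintegral_congr fun x => ?_
        simp [hG]

end Kernel

section Cutoff

lemma deriv_smoothTransition_of_neg {x : ℝ} (hx : x < 0) :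
    deriv Real.smoothTransition x = 0 := by
  have : Real.smoothTransition =ᶠ[𝓝 x] fun _ => 0 := by
    filter_upwards [Iio_mem_nhds hx] with t ht
    exact Real.smoothTransition.zero_of_nonpos (le_of_lt ht)
  rw [this.deriv_eq, deriv_const]

lemma deriv_smoothTransition_of_one_lt {x : ℝ} (hx : 1 < x) :
    deriv Real.smoothTransition x = 0 := by
  have : Real.smoothTransition =ᶠ[𝓝 x] fun _ => 1 := by
    filter_upwards [Ioi_mem_nhds hx] with t ht
    exact Real.smoothTransition.one_of_one_le (le_of_lt ht)
  rw [this.deriv_eq, deriv_const]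

lemma exists_abs_deriv_smoothTransition_le :
    ∃ K : ℝ, 0 < K ∧ ∀ x, |deriv Real.smoothTransition x| ≤ K := by
  have hc : Continuous (deriv Real.smoothTransition) :=
    (Real.smoothTransition.contDiff (n := 1)).continuous_deriv (by simp)
  have hs : HasCompactSupport (deriv Real.smoothTransition) := by
    refine HasCompactSupport.intro (K := Set.Icc 0 1) isCompact_Icc fun x hx => ?_
    rw [Set.mem_Icc, not_and_or, not_le, not_le] at hx
    exact hx.elim deriv_smoothTransition_of_neg deriv_smoothTransition_of_one_lt
  obtain ⟨C, hC⟩ := hs.exists_bound_of_continuous hc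
  exact ⟨max C 1, by positivity, fun x => (hC x).trans (le_max_left _ _)⟩

/-- A smooth bump on `ℝ`, supported in `[1/8, 7/8]` and equal to `1` on `[1/4, 3/4]`. -/
noncomputable def levelBump (r : ℝ) : ℝ :=
  Real.smoothTransition (8 * r - 1) * Real.smoothTransition (7 - 8 * r)

lemma contDiff_levelBump : ContDiff ℝ (⊤ : ℕ∞) levelBump :=
  (Real.smoothTransition.contDiff.comp (by fun_prop)).mul
    (Real.smoothTransition.contDiff.comp (by fun_prop))

lemma levelBump_nonneg (r : ℝ) : 0 ≤ levelBump r :=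
  mul_nonneg (Real.smoothTransition.nonneg _) (Real.smoothTransition.nonneg _)

lemma levelBump_le_one (r : ℝ) : levelBump r ≤ 1 :=
  mul_le_one₀ (Real.smoothTransition.le_one _) (Real.smoothTransition.nonneg _)
    (Real.smoothTransition.le_one _)

lemma levelBump_of_le {r : ℝ} (hr : r ≤ 1 / 8) : levelBump r = 0 := by
  rw [levelBump, Real.smoothTransition.zero_of_nonpos (by linarith), zero_mul]

lemma levelBump_of_ge {r : ℝ} (hr : 7 / 8 ≤ r) : levelBump r = 0 := by
  rw [levelBump, Real.smoothTransition.zero_of_nonpos (x := 7 - 8 * r) (by linarith), mul_zero]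

lemma levelBump_eq_one {r : ℝ} (h1 : 1 / 4 ≤ r) (h2 : r ≤ 3 / 4) : levelBump r = 1 := by
  rw [levelBump, Real.smoothTransition.one_of_one_le (by linarith),
    Real.smoothTransition.one_of_one_le (by linarith), one_mul]

lemma abs_deriv_smoothTransition_le_levelBump {K : ℝ}
    (hK : ∀ x, |deriv Real.smoothTransition x| ≤ K) (r : ℝ) :
    |deriv Real.smoothTransition (2 * r - 1 / 2)| ≤ K * levelBump r := by
  have hK0 : 0 ≤ K := (abs_nonneg _).trans (hK 0)
  rcases lt_or_ge r (1 / 4) with h | h1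
  · rw [deriv_smoothTransition_of_neg (by linarith), abs_zero]
    exact mul_nonneg hK0 (levelBump_nonneg r)
  rcases lt_or_ge (3 / 4) r with h | h2
  · rw [deriv_smoothTransition_of_one_lt (by linarith), abs_zero]
    exact mul_nonneg hK0 (levelBump_nonneg r)
  rw [levelBump_eq_one h1 h2, mul_one]
  exact hK _

lemma levelBump_div_ne_zero {a b : ℝ} (hb : 0 < b) (h : levelBump (a / b) ≠ 0) :
    0 < a ∧ a ≤ b ∧ b ≤ 8 * a := by
  have h1 : 1 / 8 < a / b := by
    by_contra! h'
    exact h (levelBump_of_le h')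
  have h2 : a / b < 7 / 8 := by
    by_contra! h'
    exact h (levelBump_of_ge h')
  rw [lt_div_iff₀ hb] at h1
  rw [div_lt_iff₀ hb] at h2
  exact ⟨by linarith, by linarith, by linarith⟩

lemma deriv_smoothTransition_affine (a b t : ℝ) :
    deriv (fun t => Real.smoothTransition (a * t + b)) t =
      a * deriv Real.smoothTransition (a * t + b) := by
  have h1 : HasDerivAt (fun t : ℝ => a * t + b) a t := by
    simpa using ((hasDerivAt_id t).const_mul a).add_const b
  have h2 : HasDerivAt Real.smoothTransition (deriv Real.smoothTransition (a * t + b))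
      (a * t + b) :=
    ((Real.smoothTransition.contDiff (n := 1)).differentiable (by simp) _).hasDerivAt
  exact (h2.comp t h1).deriv.trans (mul_comm _ _)

end Cutoff

section LevelSet

variable {n : ℕ} {Ω : Set (EuclideanSpace ℝ (Fin n))} {u : EuclideanSpace ℝ (Fin n) → ℝ} {s : ℝ}

lemma norm_fderiv_indicator_comp {h : ℝ → ℝ} {δ : ℝ} (hΩ : IsOpen Ω) (hu : ContDiff ℝ (⊤ : ℕ∞) u)
    (hb : ∀ x ∈ frontier Ω, u x = 0) (hδ : 0 < δ) (h0 : ∀ t ≤ δ, h t = 0)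
    (hh : ContDiff ℝ (⊤ : ℕ∞) h) (x : EuclideanSpace ℝ (Fin n)) :
    ‖fderiv ℝ (Ω.indicator fun y => h (u y)) x‖ =
      |Ω.indicator (fun y => deriv h (u y)) x| * √(gradSq u x) := by
  have : ‖fderiv ℝ (Ω.indicator fun y => h (u y)) x‖ ^ 2 =
      (|Ω.indicator (fun y => deriv h (u y)) x| * √(gradSq u x)) ^ 2 := by
    rw [norm_fderiv_eq_norm_gradient, norm_gradient_sq, mul_pow, sq_abs,
      Real.sq_sqrt gradSq_nonneg]
    simp_rw [pderiv_indicator_comp hΩ hu hb hδ h0 hh, mul_pow]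
    rw [← Finset.mul_sum]
    rfl
  exact (pow_left_inj₀ (norm_nonneg _) (by positivity) two_ne_zero).1 this

/-- Representation of `1` at a point `y` above the level `s` through the gradient of `u` on
the levels strictly between `s` and `u y`. -/
lemma volume_ball_le_lintegral (hn : 1 ≤ n) (hΩ : IsOpen Ω) (hΩb : IsBounded Ω)
    (hu : ContDiff ℝ (⊤ : ℕ∞) u) (hb : ∀ x ∈ frontier Ω, u x = 0) (hs : 0 < s) {K : ℝ}
    (hK : ∀ x, |deriv Real.smoothTransition x| ≤ K) {y : EuclideanSpace ℝ (Fin n)} (hy : y ∈ Ω)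
    (hys : s < u y) :
    volume (Metric.ball (0 : EuclideanSpace ℝ (Fin n)) 1) ≤
      ∫⁻ x in Ω, ENNReal.ofReal (2 * K / (u y - s) * levelBump ((u x - s) / (u y - s)) *
        √(gradSq u x) * ‖x - y‖ ^ (1 - (n : ℝ))) := by
  have hK0 : 0 ≤ K := (abs_nonneg _).trans (hK 0)
  set V := u y - s with hV
  have hV0 : 0 < V := sub_pos.2 hys
  set Φ : ℝ → ℝ := fun t => Real.smoothTransition (2 / V * t + (-(2 * s / V) - 1 / 2)) with hΦ
  have harg : ∀ t, 2 / V * t + (-(2 * s / V) - 1 / 2) = 2 * ((t - s) / V) - 1 / 2 := fun t => by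
    ring
  have hΦs : ContDiff ℝ (⊤ : ℕ∞) Φ := Real.smoothTransition.contDiff.comp (by fun_prop)
  have hΦ0 : ∀ t ≤ s, Φ t = 0 := fun t ht => by
    have : (t - s) / V ≤ 0 := div_nonpos_of_nonpos_of_nonneg (by linarith) hV0.le
    refine Real.smoothTransition.zero_of_nonpos ?_
    rw [harg]
    linarith
  have hFs := contDiff_indicator_comp hΩ hu hb hs hΦ0 hΦs
  have h := volume_ball_mul_enorm_le hn (hFs.of_le (by simp))
    (hasCompactSupport_indicator hΩb fun y => Φ (u y)) y
  have hF1 : Ω.indicator (fun y => Φ (u y)) y = 1 := by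
    rw [Set.indicator_of_mem hy, hΦ]
    refine Real.smoothTransition.one_of_one_le ?_
    rw [harg, ← hV, div_self hV0.ne']
    norm_num
  rw [hF1, enorm_one, mul_one] at h
  refine h.trans ?_
  rw [← lintegral_indicator hΩ.measurableSet]
  refine lintegral_mono fun x => ?_
  rw [← ofReal_norm, norm_fderiv_indicator_comp hΩ hu hb hs hΦ0 hΦs]
  by_cases hx : x ∈ Ω
  · rw [Set.indicator_of_mem hx, Set.indicator_of_mem hx,
      ← ENNReal.ofReal_mul (by positivity), deriv_smoothTransition_affine, harg, abs_mul,
      abs_of_pos (by positivity)]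
    refine ENNReal.ofReal_le_ofReal ?_
    have h1 := abs_deriv_smoothTransition_le_levelBump hK ((u x - s) / V)
    calc _ ≤ 2 / V * (K * levelBump ((u x - s) / V)) * √(gradSq u x) *
          ‖x - y‖ ^ (1 - (n : ℝ)) := by gcongr
      _ = _ := by ring
  · simp [hx]

end LevelSet

section SuperLevel

variable {n : ℕ} {Ω : Set (EuclideanSpace ℝ (Fin n))} {u : EuclideanSpace ℝ (Fin n) → ℝ} {s : ℝ}

/-- The integral of `(u - s)^q` over the superlevel set `{u > s}`. -/
noncomputable def levelMass (Ω : Set (EuclideanSpace ℝ (Fin n)))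
    (u : EuclideanSpace ℝ (Fin n) → ℝ) (s q : ℝ) : ℝ≥0∞ :=
  ∫⁻ x in Ω ∩ {x | s < u x}, ENNReal.ofReal ((u x - s) ^ q)

lemma measurableSet_superLevel (hΩ : IsOpen Ω) (hu : Continuous u) :
    MeasurableSet (Ω ∩ {x | s < u x}) :=
  (hΩ.inter (isOpen_lt continuous_const hu)).measurableSet

lemma levelMass_lt_top (hΩ : IsOpen Ω) (hΩb : IsBounded Ω) (hu : Continuous u) {q : ℝ}
    (hq : 0 ≤ q) : levelMass Ω u s q < ∞ := by
  have hc : Continuous fun x => max (u x - s) 0 ^ q :=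
    (by fun_prop : Continuous fun x => max (u x - s) 0).rpow_const fun _ => Or.inr hq
  refine lt_of_le_of_lt ?_ (integrableOn_of_continuous hΩb hc).lintegral_lt_top
  refine (setLIntegral_mono' (measurableSet_superLevel hΩ hu) fun x hx => ?_).trans
    (lintegral_mono_set Set.inter_subset_left)
  have : s < u x := hx.2
  rw [max_eq_left (by linarith)]

/-- The near-diagonal part of the representation formula. -/
lemma lintegral_near_le {θ P V q : ℝ} (hθ : 0 < θ) (hP : 0 ≤ P) (hV : 0 < V)
    (x : EuclideanSpace ℝ (Fin n)) :
    ∫⁻ y, {y | √P * ‖x - y‖ < θ * V}.indicator (fun y =>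
      ENNReal.ofReal (8 ^ (q - 1) * V ^ (q - 1) * √P * ‖x - y‖ ^ (1 - (n : ℝ)))) y ≤
      ENNReal.ofReal (8 ^ (q - 1) * θ) * kernelMass n (n - 1) * ENNReal.ofReal (V ^ q) := by
  rcases hP.eq_or_lt with rfl | hP
  · simp
  have hP' : 0 < √P := Real.sqrt_pos.2 hP
  have hset : {y | √P * ‖x - y‖ < θ * V} = Metric.ball x (θ * V / √P) := by
    ext y
    rw [Metric.mem_ball, dist_eq_norm, norm_sub_rev, lt_div_iff₀ hP', mul_comm ‖x - y‖]
    rfl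
  have hm : Measurable fun y => ENNReal.ofReal (‖x - y‖ ^ (-((n : ℝ) - 1))) :=
    ((measurable_const.sub measurable_id).norm.pow_const _).ennreal_ofReal
  rw [hset, lintegral_indicator Metric.isOpen_ball.measurableSet]
  have h1 : ∀ y, ENNReal.ofReal (8 ^ (q - 1) * V ^ (q - 1) * √P * ‖x - y‖ ^ (1 - (n : ℝ))) =
      ENNReal.ofReal (8 ^ (q - 1) * V ^ (q - 1) * √P) *
        ENNReal.ofReal (‖x - y‖ ^ (-((n : ℝ) - 1))) := fun y => by
    rw [← ENNReal.ofReal_mul (by positivity), neg_sub]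
  simp_rw [h1]
  rw [lintegral_const_mul _ hm, lintegral_ball_kernel _ _ (by positivity),
    mul_left_comm, ← ENNReal.ofReal_mul (by positivity)]
  have h2 : ENNReal.ofReal (8 ^ (q - 1) * θ) * kernelMass n (n - 1) * ENNReal.ofReal (V ^ q) =
      kernelMass n (n - 1) * ENNReal.ofReal (8 ^ (q - 1) * θ * V ^ q) := by
    rw [ENNReal.ofReal_mul (p := 8 ^ (q - 1) * θ) (by positivity)]
    ring
  have h3 : V ^ q = V ^ (q - 1) * V := by
    rw [← Real.rpow_add_one hV.ne', sub_add_cancel]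
  rw [h2]
  refine mul_le_mul' le_rfl (ENNReal.ofReal_le_ofReal (le_of_eq ?_))
  rw [sub_sub_cancel, Real.rpow_one, h3]
  field_simp

/-- The pointwise splitting of the representation formula. -/
lemma representation_split {θ P V W r q b m : ℝ} (hθ : 0 < θ) (hP : 0 ≤ P) (hV : 0 < V)
    (hW : 0 < W) (hWV : W ≤ 8 * V) (hq : 1 ≤ q) (hb0 : 0 ≤ b) (hb1 : b ≤ 1) (hr : 0 ≤ r) :
    W ^ (q - 1) * b * √P * r ^ (1 - m) ≤
      (if √P * r < θ * V then 8 ^ (q - 1) * V ^ (q - 1) * √P * r ^ (1 - m) else 0) +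
        8 / θ * (W ^ (q - 2) * b * P * r ^ (2 - m)) := by
  have h0 : 0 ≤ 8 / θ * (W ^ (q - 2) * b * P * r ^ (2 - m)) := by positivity
  split_ifs with h
  · have h1 : W ^ (q - 1) ≤ 8 ^ (q - 1) * V ^ (q - 1) := by
      rw [← Real.mul_rpow (by norm_num) hV.le]
      exact Real.rpow_le_rpow hW.le hWV (by linarith)
    have h2 : W ^ (q - 1) * b ≤ 8 ^ (q - 1) * V ^ (q - 1) :=
      (mul_le_of_le_one_right (by positivity) hb1).trans h1
    have h3 : W ^ (q - 1) * b * √P * r ^ (1 - m) ≤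
        8 ^ (q - 1) * V ^ (q - 1) * √P * r ^ (1 - m) := by gcongr
    linarith
  · rw [not_lt] at h
    have hr0 : 0 < r := by
      rcases hr.eq_or_lt with rfl | h'
      · rw [mul_zero] at h
        have := mul_pos hθ hV
        linarith
      · exact h'
    have h1 : W ≤ 8 / θ * (√P * r) := by
      rw [div_mul_eq_mul_div, le_div_iff₀ hθ]
      nlinarith
    have h2 : W ^ (q - 1) = W ^ (q - 2) * W := by
      rw [← Real.rpow_add_one hW.ne']
      congr 1
      ring
    have h3 : r ^ (2 - m) = r ^ (1 - m) * r := by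
      rw [← Real.rpow_add_one hr0.ne']
      congr 1
      ring
    rw [zero_add, h2, h3]
    calc W ^ (q - 2) * W * b * √P * r ^ (1 - m)
        ≤ W ^ (q - 2) * (8 / θ * (√P * r)) * b * √P * r ^ (1 - m) := by gcongr
      _ = 8 / θ * (W ^ (q - 2) * b * (√P * √P) * (r ^ (1 - m) * r)) := by ring
      _ = _ := by rw [Real.mul_self_sqrt hP]

lemma representation_split_ofReal {K θ P v W r q m : ℝ} (hK : 0 ≤ K) (hθ : 0 < θ) (hP : 0 ≤ P)
    (hW : 0 < W) (hq : 1 ≤ q) (hr : 0 ≤ r) :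
    ENNReal.ofReal (W ^ q) *
        ENNReal.ofReal (2 * K / W * levelBump (v / W) * √P * r ^ (1 - m)) ≤
      ENNReal.ofReal (2 * K) * ((if 0 < v ∧ √P * r < θ * v then
          ENNReal.ofReal (8 ^ (q - 1) * v ^ (q - 1) * √P * r ^ (1 - m)) else 0) +
        ENNReal.ofReal (8 / θ) *
          ENNReal.ofReal (W ^ (q - 2) * levelBump (v / W) * P * r ^ (2 - m))) := by
  rcases eq_or_ne (levelBump (v / W)) 0 with h0 | h0
  · simp [h0]
  obtain ⟨hv, -, hWv⟩ := levelBump_div_ne_zero hW h0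
  have hb := levelBump_nonneg (v / W)
  have hsp := representation_split (m := m) hθ hP hv hW hWv hq hb (levelBump_le_one _) hr
  have hT : (if 0 < v ∧ √P * r < θ * v then
      ENNReal.ofReal (8 ^ (q - 1) * v ^ (q - 1) * √P * r ^ (1 - m)) else 0) =
      ENNReal.ofReal (if √P * r < θ * v then 8 ^ (q - 1) * v ^ (q - 1) * √P * r ^ (1 - m)
        else 0) := by
    simp only [hv, true_and]
    split_ifs <;> simp
  have hW' : W ^ q = W ^ (q - 1) * W := by
    rw [← Real.rpow_add_one hW.ne', sub_add_cancel]
  rw [hT, ← ENNReal.ofReal_mul (by positivity), ← ENNReal.ofReal_mul (by positivity),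
    ← ENNReal.ofReal_add (by split_ifs <;> positivity) (by positivity),
    ← ENNReal.ofReal_mul (by positivity)]
  refine ENNReal.ofReal_le_ofReal
    (le_trans (le_of_eq ?_) (mul_le_mul_of_nonneg_left hsp (by positivity : 0 ≤ 2 * K)))
  rw [hW']
  field_simp

/-- The near-diagonal kernel in the representation formula. -/
noncomputable def nearKernel (u : EuclideanSpace ℝ (Fin n) → ℝ) (s θ q : ℝ)
    (y x : EuclideanSpace ℝ (Fin n)) : ℝ≥0∞ :=
  if 0 < u x - s ∧ √(gradSq u x) * ‖x - y‖ < θ * (u x - s) then ENNReal.ofReal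
    (8 ^ (q - 1) * (u x - s) ^ (q - 1) * √(gradSq u x) * ‖x - y‖ ^ (1 - (n : ℝ))) else 0

/-- The far kernel in the representation formula. -/
noncomputable def farKernel (u : EuclideanSpace ℝ (Fin n) → ℝ) (s q : ℝ)
    (y x : EuclideanSpace ℝ (Fin n)) : ℝ≥0∞ :=
  ENNReal.ofReal ((u y - s) ^ (q - 2) * levelBump ((u x - s) / (u y - s)) * gradSq u x *
    ‖x - y‖ ^ (2 - (n : ℝ)))

/-- The contribution of the far kernel. -/
noncomputable def levelEnergy (Ω : Set (EuclideanSpace ℝ (Fin n)))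
    (u : EuclideanSpace ℝ (Fin n) → ℝ) (s q : ℝ) : ℝ≥0∞ :=
  ∫⁻ y in Ω ∩ {x | s < u x}, ∫⁻ x in Ω, farKernel u s q y x

lemma measurable_levelBump_comp (hu : Continuous u) :
    Measurable fun z : EuclideanSpace ℝ (Fin n) × EuclideanSpace ℝ (Fin n) =>
      levelBump ((u z.2 - s) / (u z.1 - s)) :=
  contDiff_levelBump.continuous.measurable.comp
    (((hu.measurable.comp measurable_snd).sub_const s).div
      ((hu.measurable.comp measurable_fst).sub_const s))

lemma measurable_nearKernel (hu : ContDiff ℝ (⊤ : ℕ∞) u) (θ q : ℝ) :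
    Measurable (Function.uncurry (nearKernel u s θ q)) := by
  have huc := hu.continuous
  have hPc := (contDiff_gradSq hu).continuous
  have h1 : MeasurableSet {z : EuclideanSpace ℝ (Fin n) × EuclideanSpace ℝ (Fin n) |
      0 < u z.2 - s} := (isOpen_lt (by fun_prop) (by fun_prop)).measurableSet
  have h2 : MeasurableSet {z : EuclideanSpace ℝ (Fin n) × EuclideanSpace ℝ (Fin n) |
      √(gradSq u z.2) * ‖z.2 - z.1‖ < θ * (u z.2 - s)} :=
    (isOpen_lt (by fun_prop) (by fun_prop)).measurableSet
  refine Measurable.ite (h1.inter h2) ?_ measurable_const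
  exact Measurable.ennreal_ofReal (((measurable_const.mul (Measurable.pow_const
    (Continuous.measurable (by fun_prop)) _)).mul (Continuous.measurable (by fun_prop))).mul
    (Measurable.pow_const (Continuous.measurable (by fun_prop)) _))

lemma measurable_farKernel (hu : ContDiff ℝ (⊤ : ℕ∞) u) (q : ℝ) :
    Measurable (Function.uncurry (farKernel u s q)) := by
  have huc := hu.continuous
  have hPc := (contDiff_gradSq hu).continuous
  exact Measurable.ennreal_ofReal ((((Measurable.pow_const
    (Continuous.measurable (by fun_prop)) _).mul (measurable_levelBump_comp huc)).mul
    (Continuous.measurable (by fun_prop))).mul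
    (Measurable.pow_const (Continuous.measurable (by fun_prop)) _))

lemma kernel_split {K θ q : ℝ} (hK : 0 ≤ K) (hθ : 0 < θ) (hq : 1 ≤ q)
    {x y : EuclideanSpace ℝ (Fin n)} (hy : s < u y) :
    ENNReal.ofReal ((u y - s) ^ q) * ENNReal.ofReal (2 * K / (u y - s) *
        levelBump ((u x - s) / (u y - s)) * √(gradSq u x) * ‖x - y‖ ^ (1 - (n : ℝ))) ≤
      ENNReal.ofReal (2 * K) *
        (nearKernel u s θ q y x + ENNReal.ofReal (8 / θ) * farKernel u s q y x) := by
  rw [nearKernel, farKernel]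
  exact representation_split_ofReal (K := K) (θ := θ) (P := gradSq u x) (v := u x - s)
    (W := u y - s) (r := ‖x - y‖) (q := q) (m := n) hK hθ gradSq_nonneg (sub_pos.2 hy) hq
    (norm_nonneg _)

lemma lintegral_nearKernel_le {θ q : ℝ} (hθ : 0 < θ)
    {x : EuclideanSpace ℝ (Fin n)} (hx : s < u x) :
    ∫⁻ y, nearKernel u s θ q y x ≤
      ENNReal.ofReal (8 ^ (q - 1) * θ) * kernelMass n (n - 1) * ENNReal.ofReal ((u x - s) ^ q) := by
  refine le_trans (le_of_eq (lintegral_congr fun y => ?_))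
    (lintegral_near_le hθ (gradSq_nonneg (u := u) (x := x)) (sub_pos.2 hx) x)
  simp only [nearKernel, sub_pos.2 hx, true_and]
  rfl

lemma volume_ball_mul_levelMass_le (hn : 1 ≤ n) (hΩ : IsOpen Ω) (hΩb : IsBounded Ω)
    (hu : ContDiff ℝ (⊤ : ℕ∞) u) (hb : ∀ x ∈ frontier Ω, u x = 0) (hs : 0 < s) {K θ q : ℝ}
    (hK : ∀ x, |deriv Real.smoothTransition x| ≤ K) (hθ : 0 < θ) (hq : 1 ≤ q) :
    volume (Metric.ball (0 : EuclideanSpace ℝ (Fin n)) 1) * levelMass Ω u s q ≤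
      ENNReal.ofReal (2 * K) * (ENNReal.ofReal (8 ^ (q - 1) * θ) * kernelMass n (n - 1) *
        levelMass Ω u s q + ENNReal.ofReal (8 / θ) * levelEnergy Ω u s q) := by
  have hK0 : 0 ≤ K := (abs_nonneg _).trans (hK 0)
  have huc := hu.continuous
  have hU : MeasurableSet (Ω ∩ {x | s < u x}) := measurableSet_superLevel hΩ huc
  have hTm := measurable_nearKernel (s := s) hu θ q
  have hDm := measurable_farKernel (s := s) hu q
  have hpoint : ∀ y ∈ Ω ∩ {x | s < u x},
      volume (Metric.ball (0 : EuclideanSpace ℝ (Fin n)) 1) *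
      ENNReal.ofReal ((u y - s) ^ q) ≤ ENNReal.ofReal (2 * K) *
        ((∫⁻ x in Ω, nearKernel u s θ q y x) +
          ENNReal.ofReal (8 / θ) * ∫⁻ x in Ω, farKernel u s q y x) := by
    intro y hy
    have h1 := volume_ball_le_lintegral hn hΩ hΩb hu hb hs hK hy.1 hy.2
    refine (mul_le_mul' h1 le_rfl).trans ?_
    have hTy : Measurable (nearKernel u s θ q y) := hTm.of_uncurry_left
    have hDy : Measurable (farKernel u s q y) := hDm.of_uncurry_left
    rw [mul_comm, ← lintegral_const_mul' _ _ ENNReal.ofReal_ne_top,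
      ← lintegral_const_mul _ hDy, ← lintegral_add_left hTy,
      ← lintegral_const_mul' _ _ ENNReal.ofReal_ne_top]
    exact lintegral_mono fun x => kernel_split hK0 hθ hq hy.2
  have hqm : Measurable fun y => ENNReal.ofReal ((u y - s) ^ q) :=
    (Measurable.pow_const (Continuous.measurable (by fun_prop)) _).ennreal_ofReal
  have hTm' : Measurable fun y => ∫⁻ x in Ω, nearKernel u s θ q y x :=
    hTm.lintegral_prod_right
  have hDm' : Measurable fun y => ∫⁻ x in Ω, farKernel u s q y x :=
    hDm.lintegral_prod_right
  rw [levelMass, ← lintegral_const_mul _ hqm]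
  refine (setLIntegral_mono' hU hpoint).trans ?_
  rw [lintegral_const_mul' _ _ ENNReal.ofReal_ne_top, lintegral_add_left hTm',
    lintegral_const_mul _ hDm', lintegral_lintegral_swap hTm.aemeasurable,
    ← lintegral_const_mul _ hqm, levelEnergy]
  refine mul_le_mul' le_rfl (add_le_add ?_ le_rfl)
  have hV : MeasurableSet {x | s < u x} := (isOpen_lt continuous_const huc).measurableSet
  rw [Set.inter_comm Ω, ← setLIntegral_indicator hV]
  refine setLIntegral_mono' hΩ.measurableSet fun x _ => ?_
  by_cases hxs : s < u x
  · rw [Set.indicator_of_mem (show x ∈ {x | s < u x} from hxs)]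
    exact (setLIntegral_le_lintegral _ _).trans (lintegral_nearKernel_le hθ hxs)
  · simp [nearKernel, hxs]

end SuperLevel

section LevelEnergy

variable {n : ℕ} {Ω : Set (EuclideanSpace ℝ (Fin n))} {u : EuclideanSpace ℝ (Fin n) → ℝ} {s : ℝ}

lemma exists_levelMass_le (hn : 1 ≤ n) {q : ℝ} (hq : 1 ≤ q) :
    ∃ C : ℝ≥0∞, C ≠ ∞ ∧ ∀ (Ω : Set (EuclideanSpace ℝ (Fin n)))
      (u : EuclideanSpace ℝ (Fin n) → ℝ) (s : ℝ), IsOpen Ω → IsBounded Ω →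
      ContDiff ℝ (⊤ : ℕ∞) u → (∀ x ∈ frontier Ω, u x = 0) → 0 < s →
      levelMass Ω u s q ≤ C * levelEnergy Ω u s q := by
  obtain ⟨K, hK0, hK⟩ := exists_abs_deriv_smoothTransition_le
  set v := volume (Metric.ball (0 : EuclideanSpace ℝ (Fin n)) 1) with hv
  have hv0 : v ≠ 0 := (Metric.measure_ball_pos volume _ one_pos).ne'
  have hvt : v ≠ ∞ := measure_ball_lt_top.ne
  have hκ : kernelMass n (n - 1) ≠ ∞ := (kernelMass_lt_top hn (by linarith)).ne
  set κ := (kernelMass n (n - 1)).toReal with hκd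
  have hκ0 : 0 ≤ κ := ENNReal.toReal_nonneg
  have hvr : 0 < v.toReal := ENNReal.toReal_pos hv0 hvt
  set B : ℝ := 2 * K * 8 ^ (q - 1) * κ with hB
  have hB0 : 0 ≤ B := by positivity
  set θ : ℝ := v.toReal / (2 * (B + 1)) with hθd
  have hθ : 0 < θ := by positivity
  have hsmall : ENNReal.ofReal (2 * K) *
      (ENNReal.ofReal (8 ^ (q - 1) * θ) * kernelMass n (n - 1)) ≤ v / 2 := by
    rw [← ENNReal.ofReal_toReal hκ, ← hκd, ← ENNReal.ofReal_mul (by positivity),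
      ← ENNReal.ofReal_mul (by positivity)]
    refine ENNReal.ofReal_le_of_le_toReal ?_
    rw [ENNReal.toReal_div, ENNReal.toReal_ofNat]
    have : 2 * K * (8 ^ (q - 1) * θ * κ) = B * θ := by rw [hB]; ring
    rw [this, hθd, mul_div_assoc', div_le_div_iff₀ (by positivity) (by positivity)]
    nlinarith
  have hv20 : v / 2 ≠ 0 := (ENNReal.half_pos hv0).ne'
  have hv2t : v / 2 ≠ ∞ := ENNReal.div_ne_top hvt two_ne_zero
  refine ⟨(v / 2)⁻¹ * (ENNReal.ofReal (2 * K) * ENNReal.ofReal (8 / θ)),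
    ENNReal.mul_ne_top (ENNReal.inv_ne_top.2 hv20)
      (ENNReal.mul_ne_top ENNReal.ofReal_ne_top ENNReal.ofReal_ne_top),
    fun Ω u s hΩ hΩb hu hb hs => ?_⟩
  have hN : levelMass Ω u s q ≠ ∞ :=
    (levelMass_lt_top hΩ hΩb hu.continuous (by linarith)).ne
  have h1 := volume_ball_mul_levelMass_le hn hΩ hΩb hu hb hs hK hθ hq
  rw [← hv] at h1
  have h2 : v / 2 * levelMass Ω u s q + v / 2 * levelMass Ω u s q ≤
      v / 2 * levelMass Ω u s q +
        ENNReal.ofReal (2 * K) * ENNReal.ofReal (8 / θ) * levelEnergy Ω u s q := by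
    rw [← add_mul, ENNReal.add_halves]
    refine h1.trans ?_
    rw [mul_add, ← mul_assoc]
    exact add_le_add (mul_le_mul' hsmall le_rfl) (mul_assoc _ _ _).ge
  have h3 := (ENNReal.add_le_add_iff_left (ENNReal.mul_ne_top hv2t hN)).1 h2
  rw [mul_assoc, mul_comm, ← div_eq_mul_inv,
    ENNReal.le_div_iff_mul_le (Or.inl hv20) (Or.inl hv2t), mul_comm]
  exact h3

/-- The kernel dominating `farKernel` after an application of Hardy's inequality. -/
noncomputable def hessKernel (u : EuclideanSpace ℝ (Fin n) → ℝ) (s p : ℝ)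
    (y x : EuclideanSpace ℝ (Fin n)) : ℝ≥0∞ :=
  ENNReal.ofReal ((u y - s) ^ p) * ENNReal.ofReal
    (levelBump ((u x - s) / (u y - s)) * tangHess u x * ‖x - y‖ ^ (4 - (n : ℝ)))

lemma measurable_hessKernel (hu : ContDiff ℝ (⊤ : ℕ∞) u) (p : ℝ) :
    Measurable (Function.uncurry (hessKernel u s p)) := by
  have huc := hu.continuous
  have h1 : Measurable fun z : EuclideanSpace ℝ (Fin n) × EuclideanSpace ℝ (Fin n) =>
      (u z.1 - s) ^ p := Measurable.pow_const (Continuous.measurable (by fun_prop)) _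
  have h2 : Measurable fun z : EuclideanSpace ℝ (Fin n) × EuclideanSpace ℝ (Fin n) =>
      ‖z.2 - z.1‖ ^ (4 - (n : ℝ)) := Measurable.pow_const (Continuous.measurable (by fun_prop)) _
  exact h1.ennreal_ofReal.mul (((measurable_levelBump_comp huc).mul
    ((measurable_tangHess hu).comp measurable_snd)).mul h2).ennreal_ofReal

lemma levelEnergy_le (hn : 5 ≤ n) (hΩ : IsOpen Ω) (hΩb : IsBounded Ω)
    (hu : ContDiff ℝ (⊤ : ℕ∞) u) (hb : ∀ x ∈ frontier Ω, u x = 0) (hs : 0 < s) (q : ℝ) :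
    levelEnergy Ω u s q ≤ ENNReal.ofReal (2 * (n + 1)) *
      ∫⁻ y in Ω ∩ {x | s < u x}, ∫⁻ x in Ω, hessKernel u s (q - 2) y x := by
  rw [levelEnergy, ← lintegral_const_mul' _ _ ENNReal.ofReal_ne_top]
  refine setLIntegral_mono' (measurableSet_superLevel hΩ hu.continuous) fun y hy => ?_
  have hW : 0 < u y - s := sub_pos.2 hy.2
  have hh : ContDiff ℝ (⊤ : ℕ∞) fun t => levelBump ((t - s) / (u y - s)) :=
    contDiff_levelBump.comp ((contDiff_id.sub contDiff_const).div_const _)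
  have h0 : ∀ t ≤ s, levelBump ((t - s) / (u y - s)) = 0 := fun t ht =>
    levelBump_of_le ((div_nonpos_of_nonpos_of_nonneg (by linarith) hW.le).trans (by norm_num))
  have key := lintegral_hardy hn hΩ hΩb hu hb hs h0 hh (fun t => levelBump_nonneg _) y
  have h1 : ∀ x, farKernel u s q y x = ENNReal.ofReal ((u y - s) ^ (q - 2)) *
      ENNReal.ofReal (levelBump ((u x - s) / (u y - s)) * gradSq u x *
        ‖x - y‖ ^ (2 - (n : ℝ))) := fun x => by
    rw [farKernel, ← ENNReal.ofReal_mul (by positivity)]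
    congr 1
    ring
  simp_rw [h1, hessKernel]
  rw [lintegral_const_mul' _ _ ENNReal.ofReal_ne_top,
    lintegral_const_mul' _ _ ENNReal.ofReal_ne_top, mul_left_comm]
  exact mul_le_mul' le_rfl key

lemma lintegral_kernel_le {α ρ : ℝ} (hα : 0 ≤ α) (hρ : 0 < ρ)
    {S : Set (EuclideanSpace ℝ (Fin n))} (hS : volume S ≤ ENNReal.ofReal (ρ ^ (n : ℝ)))
    (x : EuclideanSpace ℝ (Fin n)) :
    ∫⁻ y in S, ENNReal.ofReal (‖x - y‖ ^ (-α)) ≤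
      (kernelMass n α + 1) * ENNReal.ofReal (ρ ^ ((n : ℝ) - α)) := by
  have hsub : S ⊆ Metric.ball x ρ ∪ S ∩ (Metric.ball x ρ)ᶜ := fun y hy => by
    by_cases h : y ∈ Metric.ball x ρ
    · exact Or.inl h
    · exact Or.inr ⟨hy, h⟩
  refine (lintegral_mono_set hsub).trans ((lintegral_union_le _ _ _).trans ?_)
  rw [add_mul, one_mul, lintegral_ball_kernel α x hρ]
  refine add_le_add le_rfl ?_
  have h1 : ∀ y ∈ (Metric.ball x ρ)ᶜ,
      ENNReal.ofReal (‖x - y‖ ^ (-α)) ≤ ENNReal.ofReal (ρ ^ (-α)) := fun y hy => by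
    rw [Set.mem_compl_iff, Metric.mem_ball, dist_comm, dist_eq_norm, not_lt] at hy
    exact ENNReal.ofReal_le_ofReal (Real.rpow_le_rpow_of_nonpos hρ hy (by linarith))
  calc ∫⁻ y in S ∩ (Metric.ball x ρ)ᶜ, ENNReal.ofReal (‖x - y‖ ^ (-α))
      = ∫⁻ y in (Metric.ball x ρ)ᶜ, ENNReal.ofReal (‖x - y‖ ^ (-α)) ∂volume.restrict S := by
        rw [Measure.restrict_restrict Metric.isOpen_ball.measurableSet.compl, Set.inter_comm]
    _ ≤ ∫⁻ _ in (Metric.ball x ρ)ᶜ, ENNReal.ofReal (ρ ^ (-α)) ∂volume.restrict S :=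
        setLIntegral_mono' Metric.isOpen_ball.measurableSet.compl h1
    _ ≤ ENNReal.ofReal (ρ ^ (-α)) * volume S := by
        rw [lintegral_const, Measure.restrict_apply_univ]
        exact mul_le_mul' le_rfl ((measure_mono (Set.subset_univ _)).trans_eq
          (Measure.restrict_apply_univ _))
    _ ≤ ENNReal.ofReal (ρ ^ (-α)) * ENNReal.ofReal (ρ ^ (n : ℝ)) := mul_le_mul' le_rfl hS
    _ = ENNReal.ofReal (ρ ^ ((n : ℝ) - α)) := by
        rw [← ENNReal.ofReal_mul (by positivity), ← Real.rpow_add hρ]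
        congr 2
        ring

/-- Chebyshev's inequality on superlevel sets. -/
lemma volume_superLevel_le {q : ℝ} (hΩ : IsOpen Ω) (hu : Continuous u) (hq : 0 ≤ q)
    {x : EuclideanSpace ℝ (Fin n)} (hx : s < u x) (hN : levelMass Ω u s q ≠ ∞) :
    volume (Ω ∩ {y | s < u y} ∩ {y | u x ≤ u y}) ≤
      ENNReal.ofReal ((levelMass Ω u s q).toReal / (u x - s) ^ q) := by
  have hv : 0 < u x - s := sub_pos.2 hx
  have hvq : 0 < (u x - s) ^ q := Real.rpow_pos_of_pos hv q
  rw [ENNReal.ofReal_div_of_pos hvq, ENNReal.ofReal_toReal hN,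
    ENNReal.le_div_iff_mul_le (Or.inl (ENNReal.ofReal_pos.2 hvq).ne')
      (Or.inl ENNReal.ofReal_ne_top), mul_comm, ← setLIntegral_const]
  refine le_trans ?_ (lintegral_mono_set (Set.inter_subset_left (t := {y | u x ≤ u y})))
  refine setLIntegral_mono' ((measurableSet_superLevel hΩ hu).inter
    (isClosed_le continuous_const hu).measurableSet) fun y hy => ENNReal.ofReal_le_ofReal ?_
  have : u x ≤ u y := hy.2
  exact Real.rpow_le_rpow hv.le (by linarith) hq

lemma hessKernel_le {p : ℝ} (hp : 0 ≤ p) {x y : EuclideanSpace ℝ (Fin n)} (hy : s < u y) :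
    hessKernel u s p y x ≤ {y | s < u x ∧ u x ≤ u y}.indicator (fun y =>
      ENNReal.ofReal (8 ^ p * (u x - s) ^ p * tangHess u x) *
        ENNReal.ofReal (‖x - y‖ ^ (-((n : ℝ) - 4)))) y := by
  have hW : 0 < u y - s := sub_pos.2 hy
  have he := tangHess_nonneg (u := u) (x := x)
  rcases eq_or_ne (levelBump ((u x - s) / (u y - s))) 0 with h0 | h0
  · simp [hessKernel, h0]
  obtain ⟨hv, hvW, hWv⟩ := levelBump_div_ne_zero hW h0
  rw [Set.indicator_of_mem (show y ∈ {y | s < u x ∧ u x ≤ u y} from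
    ⟨by linarith, by linarith⟩), hessKernel, ← ENNReal.ofReal_mul (by positivity),
    ← ENNReal.ofReal_mul (by positivity), neg_sub, ← mul_assoc]
  refine ENNReal.ofReal_le_ofReal (mul_le_mul_of_nonneg_right ?_ (by positivity))
  rw [← mul_assoc, ← Real.mul_rpow (by norm_num) hv.le]
  refine mul_le_mul_of_nonneg_right ?_ he
  exact (mul_le_of_le_one_right (by positivity) (levelBump_le_one _)).trans
    (Real.rpow_le_rpow hW.le hWv hp)

lemma setLIntegral_hessKernel_le (hn : 5 ≤ n) (hΩ : IsOpen Ω) (hu : ContDiff ℝ (⊤ : ℕ∞) u)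
    {p q : ℝ} (hp : 0 ≤ p) (hq : 0 ≤ q) (hpq : p = q * (4 / n))
    (hN0 : levelMass Ω u s q ≠ 0) (hN : levelMass Ω u s q ≠ ∞) {x : EuclideanSpace ℝ (Fin n)}
    (hx : s < u x) :
    ∫⁻ y in Ω ∩ {x | s < u x}, hessKernel u s p y x ≤
      ENNReal.ofReal (8 ^ p) * (kernelMass n (n - 4) + 1) *
        ENNReal.ofReal ((levelMass Ω u s q).toReal ^ (4 / (n : ℝ))) *
        ENNReal.ofReal (tangHess u x) := by
  have hn' : (5 : ℝ) ≤ n := by exact_mod_cast hn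
  set N := (levelMass Ω u s q).toReal with hNd
  have hNr : 0 < N := ENNReal.toReal_pos hN0 hN
  have hv : 0 < u x - s := sub_pos.2 hx
  have he := tangHess_nonneg (u := u) (x := x)
  have hL : MeasurableSet {y | u x ≤ u y} :=
    (isClosed_le continuous_const hu.continuous).measurableSet
  have hU := measurableSet_superLevel (s := s) hΩ hu.continuous
  set ρ : ℝ := (N / (u x - s) ^ q) ^ (1 / (n : ℝ)) with hρd
  have hρ : 0 < ρ := by positivity
  have hρn : ρ ^ (n : ℝ) = N / (u x - s) ^ q := by
    rw [hρd, ← Real.rpow_mul (by positivity), one_div_mul_cancel (by linarith), Real.rpow_one]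
  have hvol := volume_superLevel_le hΩ hu.continuous hq hx hN
  rw [← hNd, ← hρn] at hvol
  have hρ4 : (u x - s) ^ p * ρ ^ ((n : ℝ) - (n - 4)) = N ^ (4 / (n : ℝ)) := by
    rw [sub_sub_cancel, hρd, ← Real.rpow_mul (by positivity), one_div_mul_eq_div,
      Real.div_rpow hNr.le (by positivity), ← Real.rpow_mul hv.le, ← hpq]
    field_simp
  calc ∫⁻ y in Ω ∩ {x | s < u x}, hessKernel u s p y x
      ≤ ∫⁻ y in Ω ∩ {x | s < u x}, {y | u x ≤ u y}.indicator (fun y =>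
          ENNReal.ofReal (8 ^ p * (u x - s) ^ p * tangHess u x) *
            ENNReal.ofReal (‖x - y‖ ^ (-((n : ℝ) - 4)))) y := by
        refine setLIntegral_mono' hU fun y hy => (hessKernel_le hp hy.2).trans_eq ?_
        simp only [hx, true_and]
    _ = ENNReal.ofReal (8 ^ p * (u x - s) ^ p * tangHess u x) *
          ∫⁻ y in Ω ∩ {x | s < u x} ∩ {y | u x ≤ u y},
            ENNReal.ofReal (‖x - y‖ ^ (-((n : ℝ) - 4))) := by
        rw [setLIntegral_indicator hL, lintegral_const_mul' _ _ ENNReal.ofReal_ne_top,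
          Set.inter_comm]
    _ ≤ ENNReal.ofReal (8 ^ p * (u x - s) ^ p * tangHess u x) *
          ((kernelMass n (n - 4) + 1) * ENNReal.ofReal (ρ ^ ((n : ℝ) - (n - 4)))) :=
        mul_le_mul' le_rfl (lintegral_kernel_le (by linarith) hρ hvol x)
    _ = _ := by
        rw [← hρ4, ENNReal.ofReal_mul (p := 8 ^ p * (u x - s) ^ p) (by positivity),
          ENNReal.ofReal_mul (p := 8 ^ p) (by positivity),
          ENNReal.ofReal_mul (p := (u x - s) ^ p) (by positivity)]
        ring

lemma lintegral_hessKernel_le (hn : 5 ≤ n) (hΩ : IsOpen Ω) (hu : ContDiff ℝ (⊤ : ℕ∞) u)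
    {p q : ℝ} (hp : 0 ≤ p) (hq : 0 ≤ q) (hpq : p = q * (4 / n))
    (hN0 : levelMass Ω u s q ≠ 0) (hN : levelMass Ω u s q ≠ ∞) :
    ∫⁻ y in Ω ∩ {x | s < u x}, ∫⁻ x in Ω, hessKernel u s p y x ≤
      ENNReal.ofReal (8 ^ p) * (kernelMass n (n - 4) + 1) *
        ENNReal.ofReal ((levelMass Ω u s q).toReal ^ (4 / (n : ℝ))) *
        ∫⁻ x in Ω ∩ {x | s < u x}, ENNReal.ofReal (tangHess u x) := by
  have hU := measurableSet_superLevel (s := s) hΩ hu.continuous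
  have hV : MeasurableSet {x | s < u x} :=
    (isOpen_lt continuous_const hu.continuous).measurableSet
  rw [lintegral_lintegral_swap (measurable_hessKernel hu p).aemeasurable,
    ← lintegral_const_mul _ (measurable_tangHess hu).ennreal_ofReal,
    Set.inter_comm Ω, ← setLIntegral_indicator hV, Set.inter_comm _ Ω]
  refine setLIntegral_mono' hΩ.measurableSet fun x _ => ?_
  by_cases hxs : s < u x
  · rw [Set.indicator_of_mem (show x ∈ {x | s < u x} from hxs)]
    exact setLIntegral_hessKernel_le hn hΩ hu hp hq hpq hN0 hN hxs
  · refine (setLIntegral_mono' hU fun y hy => hessKernel_le hp hy.2).trans ?_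
    simp [hxs]

lemma exists_levelMass_rpow_le (hn : 5 ≤ n) :
    ∃ C : ℝ≥0∞, C ≠ ∞ ∧ ∀ (Ω : Set (EuclideanSpace ℝ (Fin n)))
      (u : EuclideanSpace ℝ (Fin n) → ℝ) (s : ℝ), IsOpen Ω → IsBounded Ω →
      ContDiff ℝ (⊤ : ℕ∞) u → (∀ x ∈ frontier Ω, u x = 0) → 0 < s →
      levelMass Ω u s (2 * n / (n - 4)) ^ (((n : ℝ) - 4) / n) ≤
        C * ∫⁻ x in Ω ∩ {x | s < u x}, ENNReal.ofReal (tangHess u x) := by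
  have hn' : (5 : ℝ) ≤ n := by exact_mod_cast hn
  have hn4 : 0 < (n : ℝ) - 4 := by linarith
  set q : ℝ := 2 * n / (n - 4) with hqd
  have hpq : q - 2 = q * (4 / n) := by
    rw [hqd]
    field_simp
    ring
  have hq0 : 0 < q := by positivity
  have hp : 0 ≤ q - 2 := by rw [hpq]; positivity
  obtain ⟨C, hC, hmain⟩ := exists_levelMass_le (n := n) (by omega) (q := q) (by linarith)
  have hκ : kernelMass n (n - 4) ≠ ∞ := (kernelMass_lt_top (by omega) (by linarith)).ne
  refine ⟨C * (ENNReal.ofReal (2 * (n + 1)) *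
      (ENNReal.ofReal (8 ^ (q - 2)) * (kernelMass n (n - 4) + 1))),
    ENNReal.mul_ne_top hC (ENNReal.mul_ne_top ENNReal.ofReal_ne_top
      (ENNReal.mul_ne_top ENNReal.ofReal_ne_top (ENNReal.add_ne_top.2 ⟨hκ, ENNReal.one_ne_top⟩))),
    fun Ω u s hΩ hΩb hu hb hs => ?_⟩
  have hN : levelMass Ω u s q ≠ ∞ := (levelMass_lt_top hΩ hΩb hu.continuous hq0.le).ne
  rcases eq_or_ne (levelMass Ω u s q) 0 with hN0 | hN0
  · rw [hN0, ENNReal.zero_rpow_of_pos (by positivity)]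
    exact zero_le
  have h1 := (hmain Ω u s hΩ hΩb hu hb hs).trans (mul_le_mul' le_rfl
    ((levelEnergy_le hn hΩ hΩb hu hb hs q).trans (mul_le_mul' le_rfl
      (lintegral_hessKernel_le hn hΩ hu hp hq0.le hpq hN0 hN))))
  rw [ENNReal.toReal_rpow, ENNReal.ofReal_toReal
    (ENNReal.rpow_ne_top_of_nonneg (by positivity) hN)] at h1
  have h2 : ((n : ℝ) - 4) / n = 1 - 4 / n := by field_simp
  rw [h2, ENNReal.rpow_sub _ _ hN0 hN, ENNReal.rpow_one, ENNReal.div_le_iff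
    (ENNReal.rpow_pos (pos_iff_ne_zero.2 hN0) hN).ne'
    (ENNReal.rpow_ne_top_of_nonneg (by positivity) hN)]
  refine h1.trans_eq ?_
  ring

end LevelEnergy

section SemiStable

variable {n : ℕ} {Ω : Set (EuclideanSpace ℝ (Fin n))} {u : EuclideanSpace ℝ (Fin n) → ℝ}
  {g : ℝ → ℝ} {s K : ℝ}

lemma lintegral_superLevel_tangHess_le (hΩ : IsOpen Ω) (hΩb : IsBounded Ω)
    (hg : ContDiff ℝ (⊤ : ℕ∞) g) (hu : ContDiff ℝ (⊤ : ℕ∞) u)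
    (heq : ∀ x ∈ Ω, -lap u x = g (u x)) (hb : ∀ x ∈ frontier Ω, u x = 0)
    (hst : SemiStable Ω g u) (hs : 0 < s) (hK : ∀ x, |deriv Real.smoothTransition x| ≤ K) :
    ∫⁻ x in Ω ∩ {x | s < u x}, ENNReal.ofReal (tangHess u x) ≤
      ENNReal.ofReal ((2 * K / s) ^ 2 * ∫ x in Ω ∩ {x | |u x| ≤ s}, ‖gradient u x‖ ^ 4) := by
  have huc := hu.continuous
  have hPc := (contDiff_gradSq hu).continuous
  set f : ℝ → ℝ := fun t => Real.smoothTransition (2 / s * t + -1 / 2) with hf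
  have hfs : ContDiff ℝ (⊤ : ℕ∞) f :=
    Real.smoothTransition.contDiff.comp ((contDiff_const.mul contDiff_id).add contDiff_const)
  have hd : ∀ t, deriv f t = 2 / s * deriv Real.smoothTransition (2 / s * t + -1 / 2) :=
    fun t => deriv_smoothTransition_affine _ _ t
  have h0 : ∀ t ≤ s / 4, f t = 0 := fun t ht => Real.smoothTransition.zero_of_nonpos (by
    have : 2 / s * t ≤ 2 / s * (s / 4) := by gcongr
    have h' : 2 / s * (s / 4) = 1 / 2 := by field_simp; norm_num
    linarith)
  have h1 : ∀ t, s < t → f t = 1 := fun t ht => Real.smoothTransition.one_of_one_le (by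
    have : 2 / s * s ≤ 2 / s * t := by gcongr
    have h' : 2 / s * s = 2 := by field_simp
    linarith)
  have hd0 : ∀ t, s < |t| → deriv f t = 0 := fun t ht => by
    have h' : 2 / s * s = 2 := by field_simp
    rw [hd]
    rcases lt_abs.1 ht with h | h
    · have : 2 / s * s ≤ 2 / s * t := by gcongr
      rw [deriv_smoothTransition_of_one_lt (by linarith), mul_zero]
    · have : 2 / s * s ≤ 2 / s * -t := by gcongr
      rw [deriv_smoothTransition_of_neg (by linarith), mul_zero]
  have hd1 : ∀ t, deriv f t ^ 2 ≤ (2 * K / s) ^ 2 := fun t => by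
    rw [sq_le_sq, hd, abs_mul, abs_of_pos (by positivity : 0 < 2 / s)]
    refine le_trans ?_ (le_abs_self _)
    rw [mul_div_right_comm]
    exact mul_le_mul_of_nonneg_left (hK _) (by positivity)
  have hL : MeasurableSet {x | |u x| ≤ s} :=
    (isClosed_le (by fun_prop) continuous_const).measurableSet
  have hi : IntegrableOn (fun x => (2 * K / s) ^ 2 * ‖gradient u x‖ ^ 4) Ω := by
    have : (fun x => (2 * K / s) ^ 2 * ‖gradient u x‖ ^ 4) =
        fun x => (2 * K / s) ^ 2 * gradSq u x ^ 2 := by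
      funext x
      rw [gradSq_eq]
      ring
    rw [this]
    exact integrableOn_of_continuous hΩb (by fun_prop)
  have hdc : Continuous (deriv f) := hfs.continuous_deriv (by simp)
  calc ∫⁻ x in Ω ∩ {x | s < u x}, ENNReal.ofReal (tangHess u x)
      ≤ ∫⁻ x in Ω ∩ {x | s < u x}, ENNReal.ofReal (f (u x) ^ 2 * tangHess u x) := by
        refine setLIntegral_mono' (measurableSet_superLevel hΩ huc) fun x hx => ?_
        rw [h1 _ hx.2, one_pow, one_mul]
    _ ≤ ∫⁻ x in Ω, ENNReal.ofReal (f (u x) ^ 2 * tangHess u x) :=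
        lintegral_mono_set Set.inter_subset_left
    _ ≤ ENNReal.ofReal (∫ x in Ω, gradSq u x ^ 2 * deriv f (u x) ^ 2) :=
        lintegral_tangHess_le hΩ hΩb hg hu heq hb hst (by positivity) h0 hfs
    _ ≤ _ := by
        refine ENNReal.ofReal_le_ofReal ?_
        rw [← integral_const_mul, ← setIntegral_indicator hL]
        refine integral_mono (integrableOn_of_continuous hΩb (by fun_prop)) (hi.indicator hL)
          fun x => ?_
        by_cases hx : |u x| ≤ s
        · rw [Set.indicator_of_mem (show x ∈ {x | |u x| ≤ s} from hx), gradSq_eq, mul_comm,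
            ← pow_mul]
          exact mul_le_mul_of_nonneg_right (hd1 _) (by positivity)
        · rw [Set.indicator_of_notMem (show x ∉ {x | |u x| ≤ s} from hx), hd0 _ (not_le.1 hx)]
          simp

lemma gradient_neg (x : EuclideanSpace ℝ (Fin n)) :
    gradient (fun x => -u x) x = -gradient u x := by
  simp [gradient]

lemma lap_neg (x : EuclideanSpace ℝ (Fin n)) : lap (fun x => -u x) x = -lap u x := by
  have : gradient (fun x => -u x) = -gradient u := funext gradient_neg
  simp only [lap, divg, this, fderiv_neg, neg_apply, PiLp.neg_apply, Finset.sum_neg_distrib]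

lemma SemiStable.neg (h : SemiStable Ω g u) :
    SemiStable Ω (fun t => -g (-t)) fun x => -u x := by
  intro ξ hξ h0
  have hd : ∀ t, deriv (fun t => -g (-t)) t = deriv g (-t) := fun t => by
    rw [deriv.fun_neg, deriv_comp_neg, neg_neg]
  simpa only [hd, neg_neg] using h ξ hξ h0

lemma setIntegral_abs_le_levelMass (hΩ : IsOpen Ω) (hΩb : IsBounded Ω) (hu : Continuous u)
    (hs : 0 < s) {q : ℝ} (hq : 0 ≤ q) :
    ∫ x in Ω ∩ {x | s < |u x|}, (|u x| - s) ^ q ≤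
      (levelMass Ω u s q).toReal + (levelMass Ω (fun x => -u x) s q).toReal := by
  have hV : MeasurableSet {x | s < |u x|} :=
    (isOpen_lt continuous_const hu.abs).measurableSet
  have h0 : 0 ≤ᵐ[volume.restrict (Ω ∩ {x | s < |u x|})] fun x => (|u x| - s) ^ q :=
    (ae_restrict_iff' (hΩ.measurableSet.inter hV)).2 (.of_forall fun x hx =>
      Real.rpow_nonneg (sub_nonneg.2 (le_of_lt hx.2)) q)
  have hm : Measurable fun x => (|u x| - s) ^ q :=
    Measurable.pow_const (Continuous.measurable (by fun_prop)) _
  have h1 := levelMass_lt_top (s := s) hΩ hΩb hu hq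
  have h2 := levelMass_lt_top (u := fun x => -u x) (s := s) hΩ hΩb hu.neg hq
  rw [integral_eq_lintegral_of_nonneg_ae h0 hm.aestronglyMeasurable,
    ← ENNReal.toReal_add h1.ne h2.ne]
  refine ENNReal.toReal_mono (ENNReal.add_ne_top.2 ⟨h1.ne, h2.ne⟩) ?_
  have hsub : Ω ∩ {x | s < |u x|} ⊆ (Ω ∩ {x | s < u x}) ∪ (Ω ∩ {x | s < -u x}) := by
    rw [← Set.inter_union_distrib_left]
    exact Set.inter_subset_inter_right _ fun x (hx : s < |u x|) =>
      (lt_abs.1 hx : s < u x ∨ s < -u x)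
  refine (lintegral_mono_set hsub).trans ((lintegral_union_le _ _ _).trans (add_le_add ?_ ?_))
  · refine (setLIntegral_congr_fun (measurableSet_superLevel hΩ hu) fun x hx => ?_).le
    simp only [abs_of_pos (hs.trans hx.2)]
  · refine (setLIntegral_congr_fun (measurableSet_superLevel hΩ hu.neg) fun x hx => ?_).le
    simp only [abs_of_neg (neg_pos.1 (hs.trans hx.2))]

end SemiStable

/-- The `L^{2n/(n-4)}` estimate for semi-stable solutions (Theorem 2.4, inequality (2.6)):
`(∫_{{|u|>s}} (|u|-s)^{2n/(n-4)} dx)^{(n-4)/(2n)} ≤ (C(n)/s) (∫_{{|u|≤s}} |∇u|⁴ dx)^{1/2}`. -/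
theorem stmt_10 (n : ℕ) (hn : 5 ≤ n) :
    ∃ C : ℝ, 0 < C ∧
      ∀ (Ω : Set (EuclideanSpace ℝ (Fin n))), IsOpen Ω → IsBounded Ω →
        ∀ g : ℝ → ℝ, ContDiff ℝ (⊤ : ℕ∞) g →
          ∀ u : EuclideanSpace ℝ (Fin n) → ℝ, ContDiff ℝ (⊤ : ℕ∞) u →
            (∀ x ∈ Ω, -lap u x = g (u x)) →
            (∀ x ∈ frontier Ω, u x = 0) →
            SemiStable Ω g u →
            ∀ s : ℝ, 0 < s →
              (∫ x in Ω ∩ {x | s < |u x|},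
                  (|u x| - s) ^ (2 * (n : ℝ) / ((n : ℝ) - 4))) ^ (((n : ℝ) - 4) / (2 * n)) ≤
                C / s * (∫ x in Ω ∩ {x | |u x| ≤ s}, ‖gradient u x‖ ^ 4) ^ ((1 : ℝ) / 2) := by
  have hn' : (5 : ℝ) ≤ n := by exact_mod_cast hn
  have hn4 : 0 < (n : ℝ) - 4 := by linarith
  obtain ⟨K, hK0, hK⟩ := exists_abs_deriv_smoothTransition_le
  obtain ⟨C, hC, hmain⟩ := exists_levelMass_rpow_le hn
  set c := C.toReal
  have hc : 0 ≤ c := ENNReal.toReal_nonneg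
  refine ⟨√(8 * c) * K + 1, by positivity, fun Ω hΩ hΩb g hg u hu heq hb hst s hs => ?_⟩
  have key : ∀ (g : ℝ → ℝ) (u : EuclideanSpace ℝ (Fin n) → ℝ), ContDiff ℝ (⊤ : ℕ∞) g →
      ContDiff ℝ (⊤ : ℕ∞) u → (∀ x ∈ Ω, -lap u x = g (u x)) → (∀ x ∈ frontier Ω, u x = 0) →
      SemiStable Ω g u → (levelMass Ω u s (2 * n / (n - 4))).toReal ^ (((n : ℝ) - 4) / n) ≤
        c * ((2 * K / s) ^ 2 * ∫ x in Ω ∩ {x | |u x| ≤ s}, ‖gradient u x‖ ^ 4) := by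
    intro g u hg hu heq hb hst
    have h1 := (hmain Ω u s hΩ hΩb hu hb hs).trans (mul_le_mul' le_rfl
      (lintegral_superLevel_tangHess_le hΩ hΩb hg hu heq hb hst hs hK))
    have h2 := ENNReal.toReal_mono (ENNReal.mul_ne_top hC ENNReal.ofReal_ne_top) h1
    rwa [← ENNReal.toReal_rpow, ENNReal.toReal_mul, ENNReal.toReal_ofReal (mul_nonneg
      (sq_nonneg _) (integral_nonneg fun x => by positivity))] at h2
  set q : ℝ := 2 * n / (n - 4) with hq
  set γ : ℝ := ((n : ℝ) - 4) / n with hγ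
  have hq0 : 0 ≤ q := by positivity
  have hγ0 : 0 ≤ γ := by positivity
  have hγ1 : γ ≤ 1 := by
    rw [hγ, div_le_one (by linarith)]
    linarith
  set I := ∫ x in Ω ∩ {x | |u x| ≤ s}, ‖gradient u x‖ ^ 4
  have hI : 0 ≤ I := integral_nonneg fun x => by positivity
  have hpos := key g u hg hu heq hb hst
  have hneg := key (fun t => -g (-t)) (fun x => -u x) (hg.comp contDiff_neg).neg hu.neg
    (fun x hx => by rw [lap_neg, heq x hx, neg_neg]) (fun x hx => by rw [hb x hx, neg_zero])
    hst.neg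
  simp only [abs_neg, gradient_neg, norm_neg] at hneg
  have hsum := setIntegral_abs_le_levelMass hΩ hΩb hu.continuous hs hq0
  have hJ : 0 ≤ ∫ x in Ω ∩ {x | s < |u x|}, (|u x| - s) ^ q :=
    setIntegral_nonneg (hΩ.inter (isOpen_lt continuous_const hu.continuous.abs)).measurableSet
      fun x hx => Real.rpow_nonneg (sub_nonneg.2 (le_of_lt hx.2)) q
  set J := ∫ x in Ω ∩ {x | s < |u x|}, (|u x| - s) ^ q
  have hJγ : J ^ γ ≤ ((√(8 * c) * K + 1) / s) ^ 2 * I := by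
    calc J ^ γ ≤ ((levelMass Ω u s q).toReal + (levelMass Ω (fun x => -u x) s q).toReal) ^ γ :=
          Real.rpow_le_rpow hJ hsum hγ0
      _ ≤ (levelMass Ω u s q).toReal ^ γ + (levelMass Ω (fun x => -u x) s q).toReal ^ γ :=
          Real.rpow_add_le_add_rpow ENNReal.toReal_nonneg ENNReal.toReal_nonneg hγ0 hγ1
      _ ≤ c * ((2 * K / s) ^ 2 * I) + c * ((2 * K / s) ^ 2 * I) := add_le_add hpos hneg
      _ = (√(8 * c) * K / s) ^ 2 * I := by
          linear_combination (-(K / s) ^ 2 * I) * Real.sq_sqrt (by positivity : 0 ≤ 8 * c)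
      _ ≤ ((√(8 * c) * K + 1) / s) ^ 2 * I := by
          gcongr
          linarith
  have hexp : ((n : ℝ) - 4) / (2 * n) = γ * (1 / 2) := by
    rw [hγ]
    field_simp
  rw [hexp, Real.rpow_mul hJ]
  refine (Real.rpow_le_rpow (by positivity) hJγ (by norm_num)).trans_eq ?_
  rw [Real.mul_rpow (by positivity) hI, ← Real.sqrt_eq_rpow, Real.sqrt_sq (by positivity)]
end

section
/- Let Ω ⊂ ℝⁿ be a smooth bounded domain with n ≥ 5, let g be a C^∞ function, and let u, smooth on the closure of Ω, be a semi-stable classical solution of −Δu = g(u) in Ω with u = 0 on ∂Ω. Then for every p with 1 ≤ p < 4n/(3n−4) one has ∫_Ω |∇u|^p dx ≤ p|Ω| + ( 4n/((3n−4)p) − 1 )^{−1} { ∫_Ω |u|^{2n/(n−4)} dx + ‖g(u)‖_{L¹(Ω)} }. -/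
open MeasureTheory Filter Bornology
open scoped ENNReal Topology

/-- Moment bound for a function whose distribution function decays like `t ^ (-m)`. -/
theorem integral_rpow_le_of_weak_type {α : Type*} [MeasurableSpace α] {μ : Measure α}
    [IsFiniteMeasure μ] {f : α → ℝ} (hf : Measurable f) (hf0 : ∀ x, 0 ≤ f x) {C m p : ℝ}
    (hp : 0 < p) (hpm : p < m)
    (hC : ∀ t : ℝ, 1 < t → μ.real {x | t < f x} ≤ C * t ^ (-m)) :
    ∫ x, f x ^ p ∂μ ≤ μ.real Set.univ + (m / p - 1)⁻¹ * C := by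
  have hC0 : 0 ≤ C := by
    have h := measureReal_nonneg.trans (hC 2 (by norm_num))
    exact nonneg_of_mul_nonneg_left h (by positivity)
  have hmp : 0 < m / p - 1 := by rw [sub_pos, lt_div_iff₀ hp]; linarith
  set M := μ.real Set.univ with hM
  have hM0 : 0 ≤ M := measureReal_nonneg
  rw [integral_eq_lintegral_of_nonneg_ae (ae_of_all _ fun x => Real.rpow_nonneg (hf0 x) p)
    (hf.pow_const p).aestronglyMeasurable]
  refine ENNReal.toReal_le_of_le_ofReal (by positivity) ?_
  rw [lintegral_rpow_eq_lintegral_meas_lt_mul μ (ae_of_all _ hf0) hf.aemeasurable hp]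
  have hsplit : Set.Ioi (0 : ℝ) = Set.Ioc 0 1 ∪ Set.Ioi 1 :=
    (Set.Ioc_union_Ioi_eq_Ioi zero_le_one).symm
  rw [hsplit, lintegral_union measurableSet_Ioi (Set.Ioc_disjoint_Ioi le_rfl)]
  have h1 : ∫⁻ t in Set.Ioc (0 : ℝ) 1, μ {x | t < f x} * ENNReal.ofReal (t ^ (p - 1)) ≤
      ENNReal.ofReal (M / p) := by
    calc _ ≤ ∫⁻ t in Set.Ioc (0 : ℝ) 1, ENNReal.ofReal (M * t ^ (p - 1)) := by
          refine setLIntegral_mono' measurableSet_Ioc fun t ht => ?_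
          rw [ENNReal.ofReal_mul hM0, hM, ofReal_measureReal]
          gcongr
          exact Set.subset_univ _
      _ = ENNReal.ofReal (∫ t in Set.Ioc (0 : ℝ) 1, M * t ^ (p - 1)) := by
          rw [ofReal_integral_eq_lintegral_ofReal]
          · refine Integrable.const_mul ?_ M
            exact (intervalIntegrable_iff_integrableOn_Ioc_of_le zero_le_one).1
              (intervalIntegral.intervalIntegrable_rpow' (by linarith))
          · filter_upwards [ae_restrict_mem measurableSet_Ioc] with t ht
            exact mul_nonneg hM0 (Real.rpow_nonneg ht.1.le _)
      _ = ENNReal.ofReal (M / p) := by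
          rw [integral_const_mul, ← intervalIntegral.integral_of_le zero_le_one,
            integral_rpow (Or.inl (by linarith))]
          simp [Real.zero_rpow hp.ne', div_eq_mul_inv]
  have h2 : ∫⁻ t in Set.Ioi (1 : ℝ), μ {x | t < f x} * ENNReal.ofReal (t ^ (p - 1)) ≤
      ENNReal.ofReal (C / (m - p)) := by
    calc _ ≤ ∫⁻ t in Set.Ioi (1 : ℝ), ENNReal.ofReal (C * t ^ (p - m - 1)) := by
          refine setLIntegral_mono' measurableSet_Ioi fun t ht => ?_
          have ht1 : (1 : ℝ) < t := ht
          have ht0 : (0 : ℝ) < t := by linarith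
          have : C * t ^ (p - m - 1) = (C * t ^ (-m)) * t ^ (p - 1) := by
            rw [mul_assoc, ← Real.rpow_add ht0]; ring_nf
          rw [this, ENNReal.ofReal_mul (by positivity), ← ofReal_measureReal (μ := μ)]
          gcongr
          exact hC t ht1
      _ = ENNReal.ofReal (∫ t in Set.Ioi (1 : ℝ), C * t ^ (p - m - 1)) := by
          rw [ofReal_integral_eq_lintegral_ofReal]
          · exact (integrableOn_Ioi_rpow_of_lt (by linarith) one_pos).const_mul C
          · filter_upwards [ae_restrict_mem measurableSet_Ioi] with t ht
            exact mul_nonneg hC0 (Real.rpow_nonneg (zero_le_one.trans (le_of_lt ht)) _)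
      _ = ENNReal.ofReal (C / (m - p)) := by
          rw [integral_const_mul, integral_Ioi_rpow_of_lt (by linarith) one_pos, Real.one_rpow,
            show p - m - 1 + 1 = -(m - p) by ring, neg_div_neg_eq, mul_one_div]
  calc _ ≤ ENNReal.ofReal p * (ENNReal.ofReal (M / p) + ENNReal.ofReal (C / (m - p))) := by
        gcongr
    _ = ENNReal.ofReal (M + (m / p - 1)⁻¹ * C) := by
        have : 0 < m - p := by linarith
        rw [← ENNReal.ofReal_add (by positivity) (by positivity), ← ENNReal.ofReal_mul hp.le]
        congr 1
        field_simp

/-- A `C¹` function has vanishing derivative almost everywhere on its zero set. -/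
theorem ae_fderiv_apply_eq_zero_of_eq_zero {E : Type*} [NormedAddCommGroup E] [NormedSpace ℝ E]
    [FiniteDimensional ℝ E] [MeasurableSpace E] [BorelSpace E] (μ : Measure E)
    [μ.IsAddHaarMeasure] {u : E → ℝ} (hu : ContDiff ℝ 1 u) (v : E) :
    ∀ᵐ x ∂μ, u x = 0 → fderiv ℝ u x v = 0 := by
  have hc : Continuous fun x => fderiv ℝ u x v :=
    (hu.continuous_fderiv one_ne_zero).clm_apply continuous_const
  have hs : MeasurableSet {x | u x = 0 → fderiv ℝ u x v = 0} := by
    have : {x | u x = 0 → fderiv ℝ u x v = 0} =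
        {x | u x = 0}ᶜ ∪ {x | fderiv ℝ u x v = 0} := by ext; simp [imp_iff_not_or]
    rw [this]
    exact (isClosed_eq hu.continuous continuous_const).measurableSet.compl.union
      (isClosed_eq hc continuous_const).measurableSet
  refine ae_mem_of_ae_add_linearMap_mem (LinearMap.toSpanSingleton ℝ E v) volume μ hs fun y => ?_
  have hder : ∀ t : ℝ, HasDerivAt (fun t : ℝ => u (y + t • v)) (fderiv ℝ u (y + t • v) v) t := by
    intro t
    have h1 : HasDerivAt (fun t : ℝ => y + t • v) v t := by
      simpa using ((hasDerivAt_id t).smul_const v).const_add y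
    exact ((hu.differentiable one_ne_zero).differentiableAt.hasFDerivAt).comp_hasDerivAt t h1
  set S : Set ℝ := {t | u (y + t • v) = 0 ∧ fderiv ℝ u (y + t • v) v ≠ 0} with hS
  have hcount : S.Countable := by
    refine (HereditarilyLindelofSpace.isLindelof S).countable_of_isDiscrete
      (IsDiscrete.of_nhdsWithin fun t ht => ?_)
    have hne := (hder t).eventually_ne (c := 0) ht.2
    rw [eventually_nhdsWithin_iff] at hne
    rw [le_pure_iff, mem_nhdsWithin_iff_eventually]
    filter_upwards [hne] with z hz hzS
    by_contra h
    exact hz h hzS.1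
  filter_upwards [hcount.ae_notMem volume] with t ht h0
  by_contra h
  exact ht ⟨h0, h⟩

theorem gradient_apply_eq_fderiv {n : ℕ} (u : EuclideanSpace ℝ (Fin n) → ℝ)
    (x : EuclideanSpace ℝ (Fin n)) (i : Fin n) :
    gradient u x i = fderiv ℝ u x (EuclideanSpace.single i 1) := by
  rw [← toDual_gradient, InnerProductSpace.toDual_apply_apply,
    EuclideanSpace.inner_single_right]
  simp

theorem norm_gradient_sq_s11 {n : ℕ} (u : EuclideanSpace ℝ (Fin n) → ℝ)
    (x : EuclideanSpace ℝ (Fin n)) :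
    ‖gradient u x‖ ^ 2 = ∑ i, fderiv ℝ u x (EuclideanSpace.single i 1) ^ 2 := by
  simp [EuclideanSpace.norm_sq_eq, gradient_apply_eq_fderiv]

theorem ContDiff.continuous_gradient {n : ℕ} {u : EuclideanSpace ℝ (Fin n) → ℝ}
    (hu : ContDiff ℝ 1 u) : Continuous (gradient u) :=
  (InnerProductSpace.toDual ℝ (EuclideanSpace ℝ (Fin n))).symm.continuous.comp
    (hu.continuous_fderiv one_ne_zero)

theorem lap_eq_sum {n : ℕ} {u : EuclideanSpace ℝ (Fin n) → ℝ} (hu : ContDiff ℝ 2 u)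
    (x : EuclideanSpace ℝ (Fin n)) :
    lap u x = ∑ i, fderiv ℝ (fun y => fderiv ℝ u y (EuclideanSpace.single i 1)) x
      (EuclideanSpace.single i 1) := by
  unfold lap divg
  refine Finset.sum_congr rfl fun i _ => ?_
  have hd : DifferentiableAt ℝ (gradient u) x := by
    have h : DifferentiableAt ℝ (fderiv ℝ u) x :=
      ((hu.fderiv_right (m := 1) (by norm_num)).differentiable one_ne_zero) x
    exact (InnerProductSpace.toDual ℝ (EuclideanSpace ℝ (Fin n))).symm.toContinuousLinearEquiv
      |>.differentiableAt.comp x h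
  have h := ((EuclideanSpace.proj (𝕜 := ℝ) i).hasFDerivAt.comp x hd.hasFDerivAt).fderiv
  have he : ⇑(EuclideanSpace.proj i : EuclideanSpace ℝ (Fin n) →L[ℝ] ℝ) ∘ gradient u =
      fun y => fderiv ℝ u y (EuclideanSpace.single i 1) := by
    ext y; simp [gradient_apply_eq_fderiv]
  rw [he] at h
  rw [h]
  simp

/-- If `η` is supported in `[-s, s]` and takes values in `[0, 1]`, its primitive is bounded
by `s`. -/
theorem abs_integral_le_of_support {η : ℝ → ℝ} (hη : Continuous η) (h0 : ∀ v, 0 ≤ η v)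
    (h1 : ∀ v, η v ≤ 1) {s : ℝ} (hs : 0 ≤ s) (hsupp : ∀ v, s ≤ |v| → η v = 0) (v : ℝ) :
    |∫ w in (0 : ℝ)..v, η w| ≤ s := by
  have key : ∀ w, |w| ≤ s → |∫ w in (0 : ℝ)..w, η w| ≤ s := by
    intro w hw
    have := intervalIntegral.norm_integral_le_of_norm_le_const (a := 0) (b := w) (f := η) (C := 1)
      (fun x _ => by rw [Real.norm_eq_abs, abs_of_nonneg (h0 x)]; exact h1 x)
    simp only [Real.norm_eq_abs, sub_zero, one_mul] at this
    exact this.trans hw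
  have of_edge : ∀ a, |a| = s → (∀ w ∈ Set.uIcc a v, s ≤ |w|) → |∫ w in (0 : ℝ)..v, η w| ≤ s := by
    intro a ha hw
    rw [← intervalIntegral.integral_add_adjacent_intervals (hη.intervalIntegrable 0 a)
      (hη.intervalIntegrable a v)]
    rw [intervalIntegral.integral_congr (a := a) (b := v) (g := fun _ => (0 : ℝ))
      fun w hw' => hsupp w (hw w hw')]
    simpa using key a ha.le
  rcases le_total (|v|) s with h | h
  · exact key v h
  rcases le_abs'.1 h with h' | h'
  · refine of_edge (-s) (by rw [abs_neg, abs_of_nonneg hs]) fun w hw => ?_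
    rw [Set.uIcc_of_ge h'] at hw
    exact le_abs'.2 (Or.inl hw.2)
  · refine of_edge s (abs_of_nonneg hs) fun w hw => ?_
    rw [Set.uIcc_of_le h'] at hw
    exact le_abs'.2 (Or.inr hw.1)

theorem Continuous.integrableOn_of_isBounded {n : ℕ} {Ω : Set (EuclideanSpace ℝ (Fin n))}
    (hΩb : IsBounded Ω) {f : EuclideanSpace ℝ (Fin n) → ℝ} (hf : Continuous f) :
    IntegrableOn f Ω :=
  (hf.continuousOn.integrableOn_compact hΩb.isCompact_closure).mono_set subset_closure

/-- Green's identity tested against `φ ∘ u`, where `φ` vanishes near `0` and `u` vanishes on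
the boundary; no regularity of the boundary is needed. -/
theorem integral_deriv_comp_mul_norm_gradient_sq {n : ℕ} {Ω : Set (EuclideanSpace ℝ (Fin n))}
    (hΩo : IsOpen Ω) (hΩb : IsBounded Ω) {u : EuclideanSpace ℝ (Fin n) → ℝ}
    (hu : ContDiff ℝ 2 u) (hbc : ∀ x ∈ frontier Ω, u x = 0) {φ η : ℝ → ℝ}
    (hφ : ∀ v, HasDerivAt φ (η v) v) (hη : Continuous η) (hφ0 : ∀ᶠ v in 𝓝 0, φ v = 0) :
    ∫ x in Ω, η (u x) * ‖gradient u x‖ ^ 2 = ∫ x in Ω, φ (u x) * -lap u x := by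
  have hφc : Continuous φ := continuous_iff_continuousAt.2 fun v => (hφ v).continuousAt
  have hη0 : η 0 = 0 :=
    (hφ 0).unique ((hasDerivAt_const (0 : ℝ) (0 : ℝ)).congr_of_eventuallyEq hφ0)
  have hmeas := hΩo.measurableSet
  set F : EuclideanSpace ℝ (Fin n) → ℝ := Ω.indicator fun x => φ (u x) with hF
  have hFd : ∀ x, HasFDerivAt F (Ω.indicator (fun x => η (u x) • fderiv ℝ u x) x) x := by
    intro x
    by_cases hx : x ∈ Ω
    · rw [Set.indicator_of_mem hx]
      have h := (hφ (u x)).comp_hasFDerivAt x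
        ((hu.differentiable two_ne_zero).differentiableAt.hasFDerivAt (x := x))
      refine h.congr_of_eventuallyEq ?_
      filter_upwards [hΩo.mem_nhds hx] with y hy
      rw [hF, Set.indicator_of_mem hy]; rfl
    · rw [Set.indicator_of_notMem hx]
      refine (hasFDerivAt_const (0 : ℝ) x).congr_of_eventuallyEq ?_
      by_cases hxc : x ∈ closure Ω
      · have hux : u x = 0 := hbc x (by rw [hΩo.frontier_eq]; exact ⟨hxc, hx⟩)
        have ht : Tendsto u (𝓝 x) (𝓝 0) := hux ▸ hu.continuous.tendsto x
        filter_upwards [ht.eventually hφ0] with y hy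
        by_cases hyΩ : y ∈ Ω
        · rw [hF, Set.indicator_of_mem hyΩ, hy]
        · rw [hF, Set.indicator_of_notMem hyΩ]
      · filter_upwards [isClosed_closure.isOpen_compl.mem_nhds hxc] with y hy
        rw [hF, Set.indicator_of_notMem fun h => hy (subset_closure h)]
  have hcd : ∀ i : Fin n,
      ContDiff ℝ 1 fun y => fderiv ℝ u y (EuclideanSpace.single i (1 : ℝ)) := fun i =>
    (hu.fderiv_right (m := 1) (by norm_num)).clm_apply contDiff_const
  have hcd' : ∀ i : Fin n, Continuous fun x =>
      fderiv ℝ (fun y => fderiv ℝ u y (EuclideanSpace.single i (1 : ℝ))) x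
        (EuclideanSpace.single i (1 : ℝ)) := fun i =>
    ((hcd i).continuous_fderiv one_ne_zero).clm_apply continuous_const
  have hφu : Continuous fun x => φ (u x) := hφc.comp hu.continuous
  have hηu : Continuous fun x => η (u x) := hη.comp hu.continuous
  have hibp : ∀ i : Fin n,
      ∫ x in Ω, φ (u x) * fderiv ℝ (fun y => fderiv ℝ u y (EuclideanSpace.single i 1)) x
          (EuclideanSpace.single i 1) =
        -∫ x in Ω, η (u x) * fderiv ℝ u x (EuclideanSpace.single i 1) ^ 2 := by
    intro i
    have e1 : ∀ G : EuclideanSpace ℝ (Fin n) → ℝ,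
        (fun x => F x * G x) = Ω.indicator fun x => φ (u x) * G x := by
      intro G; ext x
      by_cases hx : x ∈ Ω <;> simp [hF, hx]
    have e2 : (fun x => fderiv ℝ F x (EuclideanSpace.single i 1) *
        fderiv ℝ u x (EuclideanSpace.single i 1)) =
        Ω.indicator fun x => η (u x) * fderiv ℝ u x (EuclideanSpace.single i 1) ^ 2 := by
      ext x
      rw [(hFd x).fderiv]
      by_cases hx : x ∈ Ω
      · simp [hx]; ring
      · simp [hx]
    have h := integral_mul_fderiv_eq_neg_fderiv_mul_of_integrable (μ := volume) (f := F)
      (g := fun y => fderiv ℝ u y (EuclideanSpace.single i (1 : ℝ)))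
      (v := EuclideanSpace.single i (1 : ℝ)) ?_ ?_ ?_
      (fun x _ => (hFd x).differentiableAt)
      (fun x _ => (hcd i).differentiable one_ne_zero x)
    · rw [e1, e2, integral_indicator hmeas, integral_indicator hmeas] at h
      exact h
    · rw [e2, integrable_indicator_iff hmeas]
      exact (hηu.mul ((hcd i).continuous.pow 2)).integrableOn_of_isBounded hΩb
    · rw [e1, integrable_indicator_iff hmeas]
      exact (hφu.mul (hcd' i)).integrableOn_of_isBounded hΩb
    · rw [e1, integrable_indicator_iff hmeas]
      exact (hφu.mul (hcd i).continuous).integrableOn_of_isBounded hΩb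
  simp_rw [norm_gradient_sq_s11, lap_eq_sum hu, mul_neg, Finset.mul_sum]
  rw [integral_neg, integral_finsetSum _ fun i _ => ?_, integral_finsetSum _ fun i _ => ?_,
    Finset.sum_congr rfl fun i _ => hibp i, Finset.sum_neg_distrib, neg_neg]
  · exact (hφu.mul (hcd' i)).integrableOn_of_isBounded hΩb
  · exact (hηu.mul ((hcd i).continuous.pow 2)).integrableOn_of_isBounded hΩb

/-- Energy estimate with a continuous cut-off supported in `{δ ≤ |u| ≤ s}`. -/
theorem integral_cutoff_mul_norm_gradient_sq_le {n : ℕ} {Ω : Set (EuclideanSpace ℝ (Fin n))}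
    (hΩo : IsOpen Ω) (hΩb : IsBounded Ω) {g : ℝ → ℝ} (hg : Continuous g)
    {u : EuclideanSpace ℝ (Fin n) → ℝ} (hu : ContDiff ℝ 2 u)
    (heq : ∀ x ∈ Ω, -lap u x = g (u x)) (hbc : ∀ x ∈ frontier Ω, u x = 0)
    {η : ℝ → ℝ} (hη : Continuous η) (h0 : ∀ v, 0 ≤ η v) (h1 : ∀ v, η v ≤ 1)
    {s δ : ℝ} (hs : 0 ≤ s) (hδ : 0 < δ) (hsupp : ∀ v, s ≤ |v| → η v = 0)
    (hnear : ∀ v, |v| ≤ δ → η v = 0) :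
    ∫ x in Ω, η (u x) * ‖gradient u x‖ ^ 2 ≤ s * ∫ x in Ω, |g (u x)| := by
  have hφ : ∀ v, HasDerivAt (fun v => ∫ w in (0 : ℝ)..v, η w) (η v) v := fun v =>
    (hη.integral_hasStrictDerivAt 0 v).hasDerivAt
  have hφc : Continuous fun v => ∫ w in (0 : ℝ)..v, η w :=
    continuous_iff_continuousAt.2 fun v => (hφ v).continuousAt
  have hφ0 : ∀ᶠ v in 𝓝 (0 : ℝ), ∫ w in (0 : ℝ)..v, η w = 0 := by
    filter_upwards [Metric.ball_mem_nhds (0 : ℝ) hδ] with v hv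
    rw [intervalIntegral.integral_congr (g := fun _ => (0 : ℝ)) fun w hw => hnear w ?_]
    · simp
    · have h := Set.abs_sub_left_of_mem_uIcc hw
      rw [mem_ball_zero_iff, Real.norm_eq_abs] at hv
      simp only [sub_zero] at h
      exact h.trans hv.le
  rw [integral_deriv_comp_mul_norm_gradient_sq hΩo hΩb hu hbc hφ hη hφ0,
    setIntegral_congr_fun hΩo.measurableSet
      (g := fun x => (∫ w in (0 : ℝ)..u x, η w) * g (u x)) fun x hx => by simp only [heq x hx],
    ← integral_const_mul]
  have hgu : Continuous fun x => g (u x) := hg.comp hu.continuous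
  refine integral_mono (((hφc.comp hu.continuous).mul hgu).integrableOn_of_isBounded hΩb)
    ((continuous_const.mul hgu.abs).integrableOn_of_isBounded hΩb) fun x => ?_
  refine (le_abs_self _).trans ?_
  rw [abs_mul]
  exact mul_le_mul_of_nonneg_right (abs_integral_le_of_support hη h0 h1 hs hsupp _) (abs_nonneg _)

/-- Energy estimate on the set `{0 < |u| < s}`. -/
theorem setIntegral_norm_gradient_sq_le {n : ℕ} {Ω : Set (EuclideanSpace ℝ (Fin n))}
    (hΩo : IsOpen Ω) (hΩb : IsBounded Ω) {g : ℝ → ℝ} (hg : Continuous g)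
    {u : EuclideanSpace ℝ (Fin n) → ℝ} (hu : ContDiff ℝ 2 u)
    (heq : ∀ x ∈ Ω, -lap u x = g (u x)) (hbc : ∀ x ∈ frontier Ω, u x = 0)
    {s : ℝ} (hs : 0 ≤ s) :
    ∫ x in Ω, {x | 0 < |u x| ∧ |u x| < s}.indicator (fun x => ‖gradient u x‖ ^ 2) x ≤
      s * ∫ x in Ω, |g (u x)| := by
  let c : ℝ → ℝ := fun r => max 0 (min 1 r)
  have hc : Continuous c := by fun_prop
  have hc0 : ∀ r, 0 ≤ c r := fun r => le_max_left _ _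
  have hc1 : ∀ r, c r ≤ 1 := fun r => max_le zero_le_one (min_le_left _ _)
  have hcneg : ∀ r, r ≤ 0 → c r = 0 := fun r hr => max_eq_left ((min_le_right _ _).trans hr)
  have hcone : ∀ r, 1 ≤ r → c r = 1 := fun r hr => by simp [c, hr]
  let η : ℕ → ℝ → ℝ := fun k v => c (k * |v| - 1) * c (k * (s - |v|))
  have hη : ∀ k, Continuous (η k) := fun k => by fun_prop
  have hη0 : ∀ k v, 0 ≤ η k v := fun k v => mul_nonneg (hc0 _) (hc0 _)
  have hη1 : ∀ k v, η k v ≤ 1 := fun k v => mul_le_one₀ (hc1 _) (hc0 _) (hc1 _)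
  have hG : Continuous fun x => ‖gradient u x‖ ^ 2 :=
    (hu.of_le one_le_two).continuous_gradient.norm.pow 2
  have hlim : Tendsto (fun k => ∫ x in Ω, η k (u x) * ‖gradient u x‖ ^ 2) atTop
      (𝓝 (∫ x in Ω, {x | 0 < |u x| ∧ |u x| < s}.indicator (fun x => ‖gradient u x‖ ^ 2) x)) := by
    refine tendsto_integral_of_dominated_convergence (fun x => ‖gradient u x‖ ^ 2)
      (fun k => (((hη k).comp hu.continuous).mul hG).aestronglyMeasurable)
      (hG.integrableOn_of_isBounded hΩb) (fun k => ae_of_all _ fun x => ?_)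
      (ae_of_all _ fun x => ?_)
    · rw [Real.norm_eq_abs, abs_of_nonneg (mul_nonneg (hη0 _ _) (sq_nonneg _))]
      exact mul_le_of_le_one_left (sq_nonneg _) (hη1 _ _)
    · by_cases hx : 0 < |u x| ∧ |u x| < s
      · rw [Set.indicator_of_mem (s := {x | 0 < |u x| ∧ |u x| < s}) hx]
        refine tendsto_const_nhds.congr' ?_
        have t1 : ∀ᶠ k : ℕ in atTop, 2 ≤ (k : ℝ) * |u x| :=
          (tendsto_natCast_atTop_atTop.atTop_mul_const hx.1).eventually_ge_atTop 2
        have t2 : ∀ᶠ k : ℕ in atTop, 1 ≤ (k : ℝ) * (s - |u x|) :=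
          (tendsto_natCast_atTop_atTop.atTop_mul_const (sub_pos.2 hx.2)).eventually_ge_atTop 1
        filter_upwards [t1, t2] with k h1 h2
        simp only [η]
        rw [hcone _ (by linarith), hcone _ h2, one_mul, one_mul]
      · rw [Set.indicator_of_notMem (s := {x | 0 < |u x| ∧ |u x| < s}) hx]
        refine tendsto_const_nhds.congr fun k => ?_
        suffices η k (u x) = 0 by rw [this, zero_mul]
        rw [not_and_or, not_lt, not_lt] at hx
        simp only [η]
        rcases hx with hx | hx
        · rw [hcneg (k * |u x| - 1), zero_mul]
          rw [le_antisymm hx (abs_nonneg _)]; norm_num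
        · rw [hcneg (k * (s - |u x|)), mul_zero]
          exact mul_nonpos_of_nonneg_of_nonpos k.cast_nonneg (by linarith)
  refine le_of_tendsto hlim ((eventually_gt_atTop 0).mono fun k hk => ?_)
  have hk' : (0 : ℝ) < k := by exact_mod_cast hk
  refine integral_cutoff_mul_norm_gradient_sq_le hΩo hΩb hg hu heq hbc (hη k) (hη0 k) (hη1 k) hs
    (δ := (k : ℝ)⁻¹) (by positivity) (fun v hv => ?_) fun v hv => ?_
  · simp only [η]
    rw [hcneg (k * (s - |v|)), mul_zero]
    exact mul_nonpos_of_nonneg_of_nonpos k.cast_nonneg (by linarith)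
  · simp only [η]
    rw [hcneg (k * |v| - 1), zero_mul]
    have := mul_le_mul_of_nonneg_left hv hk'.le
    rw [mul_inv_cancel₀ hk'.ne'] at this
    linarith

/-- Weak-type bound for the gradient of a solution, with the truncation level `s` free. -/
theorem measureReal_lt_norm_gradient_le {n : ℕ} {Ω : Set (EuclideanSpace ℝ (Fin n))}
    (hΩo : IsOpen Ω) (hΩb : IsBounded Ω) {g : ℝ → ℝ} (hg : Continuous g)
    {u : EuclideanSpace ℝ (Fin n) → ℝ} (hu : ContDiff ℝ 2 u)
    (heq : ∀ x ∈ Ω, -lap u x = g (u x)) (hbc : ∀ x ∈ frontier Ω, u x = 0)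
    {q s t : ℝ} (hq : 0 < q) (hs : 0 < s) (ht : 0 < t) :
    (volume.restrict Ω).real {x | t < ‖gradient u x‖} ≤
      s ^ (-q) * (∫ x in Ω, |u x| ^ q) + s / t ^ 2 * ∫ x in Ω, |g (u x)| := by
  have : IsFiniteMeasure (volume.restrict Ω) :=
    isFiniteMeasure_restrict.2 hΩb.measure_lt_top.ne
  set μ := volume.restrict Ω
  set S : Set (EuclideanSpace ℝ (Fin n)) := {x | 0 < |u x| ∧ |u x| < s} with hS
  have hG : Continuous fun x => ‖gradient u x‖ ^ 2 :=
    (hu.of_le one_le_two).continuous_gradient.norm.pow 2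
  have hSm : MeasurableSet S :=
    ((isOpen_lt continuous_const hu.continuous.abs).inter
      (isOpen_lt hu.continuous.abs continuous_const)).measurableSet
  have hnull : ∀ᵐ x ∂μ, u x = 0 → gradient u x = 0 := by
    have h : ∀ᵐ x ∂(volume : Measure (EuclideanSpace ℝ (Fin n))),
        ∀ i : Fin n, u x = 0 → fderiv ℝ u x (EuclideanSpace.single i 1) = 0 :=
      ae_all_iff.2 fun i =>
        ae_fderiv_apply_eq_zero_of_eq_zero volume (hu.of_le one_le_two) _
    filter_upwards [ae_restrict_of_ae h] with x hx h0
    ext i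
    rw [gradient_apply_eq_fderiv, hx i h0]; rfl
  have huq : Continuous fun x => |u x| ^ q :=
    hu.continuous.abs.rpow_const fun _ => Or.inr hq.le
  have hA : μ.real {x | s ^ q ≤ |u x| ^ q} ≤ s ^ (-q) * ∫ x, |u x| ^ q ∂μ := by
    have h := mul_meas_ge_le_integral_of_nonneg (μ := μ)
      (ae_of_all _ fun x => Real.rpow_nonneg (abs_nonneg (u x)) q)
      (huq.integrableOn_of_isBounded hΩb) (s ^ q)
    rw [Real.rpow_neg hs.le, inv_mul_eq_div, le_div_iff₀ (by positivity), mul_comm]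
    exact h
  have hB : μ.real {x | t ^ 2 ≤ S.indicator (fun x => ‖gradient u x‖ ^ 2) x} ≤
      s / t ^ 2 * ∫ x, |g (u x)| ∂μ := by
    have h := mul_meas_ge_le_integral_of_nonneg (μ := μ)
      (f := S.indicator fun x => ‖gradient u x‖ ^ 2)
      (ae_of_all _ fun x => Set.indicator_nonneg (fun _ _ => sq_nonneg _) x)
      ((hG.integrableOn_of_isBounded hΩb).indicator hSm) (t ^ 2)
    rw [div_mul_eq_mul_div, le_div_iff₀ (by positivity), mul_comm]
    exact h.trans (setIntegral_norm_gradient_sq_le hΩo hΩb hg hu heq hbc hs.le)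
  calc μ.real {x | t < ‖gradient u x‖}
      ≤ μ.real ({x | s ^ q ≤ |u x| ^ q} ∪
          {x | t ^ 2 ≤ S.indicator (fun x => ‖gradient u x‖ ^ 2) x}) := by
        refine ENNReal.toReal_mono (measure_ne_top _ _) (measure_mono_ae ?_)
        filter_upwards [hnull] with x hx hxt
        have hxt : t < ‖gradient u x‖ := hxt
        have hne : u x ≠ 0 := by
          intro h0
          rw [hx h0, norm_zero] at hxt
          exact hxt.not_gt ht
        rcases le_or_gt s |u x| with h | h
        · exact Or.inl (Real.rpow_le_rpow hs.le h hq.le)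
        · right
          have hxS : x ∈ S := ⟨abs_pos.2 hne, h⟩
          change t ^ 2 ≤ S.indicator (fun x => ‖gradient u x‖ ^ 2) x
          rw [Set.indicator_of_mem hxS]
          exact pow_le_pow_left₀ ht.le hxt.le 2
    _ ≤ _ := (measureReal_union_le _ _).trans (add_le_add hA hB)

/-- The `W^{1,p}` estimate for semi-stable solutions (Theorem 2.4, inequality (2.7)):
for `1 ≤ p < 4n/(3n-4)`,
`∫_Ω |∇u|^p dx ≤ p|Ω| + (4n/((3n-4)p) - 1)⁻¹ {∫_Ω |u|^{2n/(n-4)} dx + ‖g(u)‖_{L¹(Ω)}}`. -/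
theorem stmt_11 (n : ℕ) (hn : 5 ≤ n)
    (Ω : Set (EuclideanSpace ℝ (Fin n))) (hΩo : IsOpen Ω) (hΩb : IsBounded Ω)
    (g : ℝ → ℝ) (hg : ContDiff ℝ (⊤ : ℕ∞) g)
    (u : EuclideanSpace ℝ (Fin n) → ℝ) (hu : ContDiff ℝ (⊤ : ℕ∞) u)
    (heq : ∀ x ∈ Ω, -lap u x = g (u x))
    (hbc : ∀ x ∈ frontier Ω, u x = 0)
    (hstab : SemiStable Ω g u) :
    ∀ p : ℝ, 1 ≤ p → p < 4 * (n : ℝ) / (3 * (n : ℝ) - 4) →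
      ∫ x in Ω, ‖gradient u x‖ ^ p ≤
        p * (volume Ω).toReal +
          (4 * (n : ℝ) / ((3 * (n : ℝ) - 4) * p) - 1)⁻¹ *
            ((∫ x in Ω, |u x| ^ (2 * (n : ℝ) / ((n : ℝ) - 4))) +
              ∫ x in Ω, |g (u x)|) := by
  intro p hp1 hpm
  have hn5 : (5 : ℝ) ≤ n := by exact_mod_cast hn
  have hn4 : (0 : ℝ) < (n : ℝ) - 4 := by linarith
  have hd : (0 : ℝ) < 3 * (n : ℝ) - 4 := by linarith
  have hp : 0 < p := by linarith
  have : IsFiniteMeasure (volume.restrict Ω) :=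
    isFiniteMeasure_restrict.2 hΩb.measure_lt_top.ne
  have hu2 : ContDiff ℝ 2 u := contDiff_infty.1 hu 2
  have hweak : ∀ t : ℝ, 1 < t → (volume.restrict Ω).real {x | t < ‖gradient u x‖} ≤
      ((∫ x in Ω, |u x| ^ (2 * (n : ℝ) / ((n : ℝ) - 4))) + ∫ x in Ω, |g (u x)|) *
        t ^ (-(4 * (n : ℝ) / (3 * (n : ℝ) - 4))) := by
    intro t ht
    have ht0 : 0 < t := by linarith
    have h := measureReal_lt_norm_gradient_le hΩo hΩb hg.continuous hu2 heq hbc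
      (q := 2 * (n : ℝ) / ((n : ℝ) - 4))
      (s := t ^ (2 * ((n : ℝ) - 4) / (3 * (n : ℝ) - 4))) (by positivity) (by positivity) ht0
    have e1 : (t ^ (2 * ((n : ℝ) - 4) / (3 * (n : ℝ) - 4))) ^ (-(2 * (n : ℝ) / ((n : ℝ) - 4))) =
        t ^ (-(4 * (n : ℝ) / (3 * (n : ℝ) - 4))) := by
      rw [← Real.rpow_mul ht0.le]
      congr 1
      field_simp
      ring
    have e2 : t ^ (2 * ((n : ℝ) - 4) / (3 * (n : ℝ) - 4)) / t ^ 2 =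
        t ^ (-(4 * (n : ℝ) / (3 * (n : ℝ) - 4))) := by
      rw [← Real.rpow_natCast t 2, ← Real.rpow_sub ht0]
      congr 1
      push_cast
      rw [div_sub' hd.ne', ← neg_div]
      ring
    rw [e1, e2, ← mul_add, mul_comm] at h
    exact h
  have h := integral_rpow_le_of_weak_type
    (hu2.of_le one_le_two).continuous_gradient.norm.measurable (fun x => norm_nonneg _) hp hpm hweak
  rw [div_div, measureReal_restrict_apply_univ] at h
  refine h.trans (add_le_add_left ?_ _)
  exact le_mul_of_one_le_left measureReal_nonneg hp1
end
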